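/- arXiv:2212.05385 — 4 statements merged into one kernel-verified Lean document; each statement's English description precedes it below -/
import Mathlib

section
/- There exists a unique unital algebra homomorphism ♮ : ℋ → U(sl₂)⊗U(sl₂) such that ♮(A) = (H⊗1 − 1⊗H)/4, ♮(B) = Δ(Λ)/2, and ♮(C) = E⊗F − F⊗E. Moreover, this homomorphism ♮ sends α to (Λ⊗1 + 1⊗Λ)/2 + Δ(H)²/8 and sends β to ((Λ⊗1 − 1⊗Λ)·Δ(H))/2. -/
open scoped TensorProduct
open scoped Classical

noncomputable section
/-- Generators `E`, `F`, `H` of the universal enveloping algebra of `sl₂`. -/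
inductive UGen : Type | E | F | H

/-- The defining relations of `U(sl₂)`: `[H,E] = 2E`, `[H,F] = -2F`, `[E,F] = H`. -/
inductive URel : FreeAlgebra ℂ UGen → FreeAlgebra ℂ UGen → Prop
  | HE : URel (FreeAlgebra.ι ℂ UGen.H * FreeAlgebra.ι ℂ UGen.E -
        FreeAlgebra.ι ℂ UGen.E * FreeAlgebra.ι ℂ UGen.H) (2 * FreeAlgebra.ι ℂ UGen.E)
  | HF : URel (FreeAlgebra.ι ℂ UGen.H * FreeAlgebra.ι ℂ UGen.F -
        FreeAlgebra.ι ℂ UGen.F * FreeAlgebra.ι ℂ UGen.H) (-(2 * FreeAlgebra.ι ℂ UGen.F))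
  | EF : URel (FreeAlgebra.ι ℂ UGen.E * FreeAlgebra.ι ℂ UGen.F -
        FreeAlgebra.ι ℂ UGen.F * FreeAlgebra.ι ℂ UGen.E) (FreeAlgebra.ι ℂ UGen.H)

/-- The universal enveloping algebra `U(sl₂)`, presented by generators and relations. -/
abbrev Usl2 : Type := RingQuot URel

/-- The element `E` of `U(sl₂)`. -/
def UE : Usl2 := RingQuot.mkAlgHom ℂ URel (FreeAlgebra.ι ℂ UGen.E)

/-- The element `F` of `U(sl₂)`. -/
def UF : Usl2 := RingQuot.mkAlgHom ℂ URel (FreeAlgebra.ι ℂ UGen.F)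

/-- The element `H` of `U(sl₂)`. -/
def UH : Usl2 := RingQuot.mkAlgHom ℂ URel (FreeAlgebra.ι ℂ UGen.H)

/-- The Casimir element `Λ = EF + FE + H²/2` of `U(sl₂)`. -/
def Casimir : Usl2 := UE * UF + UF * UE + (1/2 : ℂ) • (UH * UH)
/-- Generators `A`, `B`, `C` of the universal Hahn algebra. -/
inductive HGen : Type | A | B | C

/-- `A` as an element of the free algebra on `HGen`. -/
def fA : FreeAlgebra ℂ HGen := FreeAlgebra.ι ℂ HGen.A

/-- `B` as an element of the free algebra on `HGen`. -/
def fB : FreeAlgebra ℂ HGen := FreeAlgebra.ι ℂ HGen.B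

/-- `C` as an element of the free algebra on `HGen`. -/
def fC : FreeAlgebra ℂ HGen := FreeAlgebra.ι ℂ HGen.C

/-- `α = [C,A] + 2A² + B` in the free algebra. -/
def fAlpha : FreeAlgebra ℂ HGen := (fC * fA - fA * fC) + 2 * (fA * fA) + fB

/-- `β = [B,C] + 4BA + 2C` in the free algebra. -/
def fBeta : FreeAlgebra ℂ HGen := (fB * fC - fC * fB) + 4 * (fB * fA) + 2 * fC

/-- The defining relations of the universal Hahn algebra `ℋ`:
`[A,B] = C`, and each of `α`, `β` commutes with each generator (hence is central). -/
inductive HRel : FreeAlgebra ℂ HGen → FreeAlgebra ℂ HGen → Prop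
  | com : HRel (fA * fB - fB * fA) fC
  | alphaA : HRel (fAlpha * fA) (fA * fAlpha)
  | alphaB : HRel (fAlpha * fB) (fB * fAlpha)
  | alphaC : HRel (fAlpha * fC) (fC * fAlpha)
  | betaA : HRel (fBeta * fA) (fA * fBeta)
  | betaB : HRel (fBeta * fB) (fB * fBeta)
  | betaC : HRel (fBeta * fC) (fC * fBeta)

/-- The universal Hahn algebra `ℋ`. -/
abbrev HahnAlg : Type := RingQuot HRel

/-- The element `A` of `ℋ`. -/
def HA : HahnAlg := RingQuot.mkAlgHom ℂ HRel fA

/-- The element `B` of `ℋ`. -/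
def HB : HahnAlg := RingQuot.mkAlgHom ℂ HRel fB

/-- The element `C` of `ℋ`. -/
def HC : HahnAlg := RingQuot.mkAlgHom ℂ HRel fC

/-- The central element `α = [C,A] + 2A² + B` of `ℋ`. -/
def hahnAlpha : HahnAlg := (HC * HA - HA * HC) + 2 * (HA * HA) + HB

/-- The central element `β = [B,C] + 4BA + 2C` of `ℋ`. -/
def hahnBeta : HahnAlg := (HB * HC - HC * HB) + 4 * (HB * HA) + 2 * HC
/-- `(e, f, h)` satisfies the defining relations of `sl₂`. -/
structure IsSl2Rel {R : Type*} [Ring R] (e f h : R) : Prop where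
  he : h * e = e * h + 2 * e
  hf : h * f = f * h - 2 * f
  fe : f * e = e * f - h

namespace IsSl2Rel

variable {R S : Type*} [Ring R] {e f h : R}

theorem map [Algebra ℂ R] [Ring S] [Algebra ℂ S] {e f h : S} (r : IsSl2Rel e f h)
    (φ : S →ₐ[ℂ] R) :
    IsSl2Rel (φ e) (φ f) (φ h) where
  he := by simpa [two_mul] using congrArg φ r.he
  hf := by simpa [two_mul] using congrArg φ r.hf
  fe := by simpa using congrArg φ r.fe

theorem he_assoc (r : IsSl2Rel e f h) (x : R) : h * (e * x) = e * (h * x) + 2 * (e * x) := by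
  rw [← mul_assoc, r.he]; noncomm_ring

theorem hf_assoc (r : IsSl2Rel e f h) (x : R) : h * (f * x) = f * (h * x) - 2 * (f * x) := by
  rw [← mul_assoc, r.hf]; noncomm_ring

theorem fe_assoc (r : IsSl2Rel e f h) (x : R) : f * (e * x) = e * (f * x) - h * x := by
  rw [← mul_assoc, r.fe]; noncomm_ring

variable [Algebra ℂ R]

/-- The Casimir element of a triple of `sl₂`-generators. -/
def casimir (e f h : R) : R := e * f + f * e + (1/2 : ℂ) • (h * h)

theorem commute_casimir_e (r : IsSl2Rel e f h) : Commute (casimir e f h) e := by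
  simp only [Commute, SemiconjBy, casimir, mul_add, add_mul, smul_mul_assoc, mul_smul_comm,
    mul_assoc, r.he, r.fe, r.he_assoc, mul_sub, sub_mul, two_mul]
  module

theorem commute_casimir_f (r : IsSl2Rel e f h) : Commute (casimir e f h) f := by
  simp only [Commute, SemiconjBy, casimir, mul_add, add_mul, smul_mul_assoc, mul_smul_comm,
    mul_assoc, r.hf, r.fe, r.hf_assoc, r.fe_assoc, mul_sub, sub_mul, two_mul]
  module

theorem commute_casimir_h (r : IsSl2Rel e f h) : Commute (casimir e f h) h := by
  simp only [Commute, SemiconjBy, casimir, mul_add, add_mul, smul_mul_assoc, mul_smul_comm,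
    mul_assoc, r.hf, r.fe, r.he_assoc, mul_sub, sub_mul, two_mul]
  module

end IsSl2Rel

/-- Two copies of `sl₂` inside an algebra that commute with each other. -/
structure IsCommutingSl2Pair {R : Type*} [Ring R] (e f h e' f' h' : R) : Prop where
  left : IsSl2Rel e f h
  right : IsSl2Rel e' f' h'
  ee : e' * e = e * e'
  ef : e' * f = f * e'
  eh : e' * h = h * e'
  fe : f' * e = e * f'
  ff : f' * f = f * f'
  fh : f' * h = h * f'
  he : h' * e = e * h'
  hf : h' * f = f * h'
  hh : h' * h = h * h'

namespace IsCommutingSl2Pair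

open IsSl2Rel

variable {R : Type*} [Ring R] {e f h e' f' h' : R}

theorem left_comm_of_mul_eq {a b : R} (hab : a * b = b * a) (x : R) :
    a * (b * x) = b * (a * x) := by
  rw [← mul_assoc, hab, mul_assoc]

theorem symm (p : IsCommutingSl2Pair e f h e' f' h') : IsCommutingSl2Pair e' f' h' e f h :=
  ⟨p.right, p.left, p.ee.symm, p.fe.symm, p.he.symm, p.ef.symm, p.ff.symm, p.hf.symm,
    p.eh.symm, p.fh.symm, p.hh.symm⟩

variable [Algebra ℂ R]

theorem casimir_add (p : IsCommutingSl2Pair e f h e' f' h') :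
    casimir (e + e') (f + f') (h + h') =
      casimir e f h + casimir e' f' h' + (2 : ℂ) • (e * f' + f * e') + h * h' := by
  simp only [casimir, mul_add, add_mul, p.fe, p.ef, p.hh]
  module

theorem commutator_diff_casimir (p : IsCommutingSl2Pair e f h e' f' h') :
    (1/4 : ℂ) • (h - h') * (1/2 : ℂ) • casimir (e + e') (f + f') (h + h') -
      (1/2 : ℂ) • casimir (e + e') (f + f') (h + h') * (1/4 : ℂ) • (h - h') =
    e * f' - f * e' := by
  simp only [casimir, mul_add, add_mul, smul_add, smul_sub, smul_mul_assoc, mul_smul_comm,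
    mul_assoc, mul_sub, sub_mul, two_mul, p.left.hf, p.left.fe, p.right.he, p.right.hf, p.right.fe,
    p.left.he_assoc, p.left.hf_assoc, p.right.he_assoc, p.ef, p.eh, p.fe, p.fh, p.hf, p.hh,
    left_comm_of_mul_eq p.eh, left_comm_of_mul_eq p.he, left_comm_of_mul_eq p.hf,
    left_comm_of_mul_eq p.hh]
  module

theorem alpha_eq (p : IsCommutingSl2Pair e f h e' f' h') :
    ((e * f' - f * e') * (1/4 : ℂ) • (h - h') - (1/4 : ℂ) • (h - h') * (e * f' - f * e')) +
      2 * ((1/4 : ℂ) • (h - h') * (1/4 : ℂ) • (h - h')) +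
      (1/2 : ℂ) • casimir (e + e') (f + f') (h + h') =
    (1/2 : ℂ) • (casimir e f h + casimir e' f' h') + (1/8 : ℂ) • ((h + h') * (h + h')) := by
  simp only [casimir, mul_add, add_mul, smul_add, smul_sub, smul_mul_assoc, mul_smul_comm,
    mul_assoc, mul_sub, sub_mul, two_mul, p.left.fe, p.right.he, p.right.hf, p.right.fe,
    p.left.he_assoc, p.left.hf_assoc, p.ef, p.eh, p.fe, p.fh, p.hh, left_comm_of_mul_eq p.he,
    left_comm_of_mul_eq p.hf]
  module

theorem beta_eq (p : IsCommutingSl2Pair e f h e' f' h') :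
    ((1/2 : ℂ) • casimir (e + e') (f + f') (h + h') * (e * f' - f * e') -
      (e * f' - f * e') * (1/2 : ℂ) • casimir (e + e') (f + f') (h + h')) +
      4 * ((1/2 : ℂ) • casimir (e + e') (f + f') (h + h') * (1/4 : ℂ) • (h - h')) +
      2 * (e * f' - f * e') =
    (1/2 : ℂ) • ((casimir e f h - casimir e' f' h') * (h + h')) := by
  simp only [casimir, mul_add, add_mul, smul_add, smul_sub, smul_mul_assoc, mul_smul_comm,
    mul_assoc, mul_sub, sub_mul, two_mul, ← two_add_two_eq_four, p.left.fe, p.right.he, p.right.hf,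
    p.right.fe, p.left.he_assoc, p.left.hf_assoc, p.left.fe_assoc, p.right.he_assoc,
    p.right.hf_assoc, p.right.fe_assoc, p.ef, p.eh, p.fe, p.ff, p.fh, p.hh,
    left_comm_of_mul_eq p.ee, left_comm_of_mul_eq p.ef, left_comm_of_mul_eq p.eh,
    left_comm_of_mul_eq p.fe, left_comm_of_mul_eq p.ff, left_comm_of_mul_eq p.fh,
    left_comm_of_mul_eq p.he, left_comm_of_mul_eq p.hf, left_comm_of_mul_eq p.hh]
  module

theorem commute_casimir_left (p : IsCommutingSl2Pair e f h e' f' h') {x : R}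
    (hx : x = e ∨ x = f ∨ x = h ∨ x = e' ∨ x = f' ∨ x = h') : Commute (casimir e f h) x := by
  have key {y : R} (he : Commute e y) (hf : Commute f y) (hh : Commute h y) :
      Commute (casimir e f h) y :=
    ((he.mul_left hf).add_left (hf.mul_left he)).add_left ((hh.mul_left hh).smul_left _)
  rcases hx with rfl | rfl | rfl | rfl | rfl | rfl
  · exact p.left.commute_casimir_e
  · exact p.left.commute_casimir_f
  · exact p.left.commute_casimir_h
  · exact key p.ee.symm p.ef.symm p.eh.symm
  · exact key p.fe.symm p.ff.symm p.fh.symm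
  · exact key p.he.symm p.hf.symm p.hh.symm

/-- Anything commuting with the Casimir elements, `h`, `h'`, `e f'` and `f e'` commutes with the
images of the generators of the Hahn algebra. -/
theorem commute_generators (p : IsCommutingSl2Pair e f h e' f' h') {x : R}
    (hc : Commute x (casimir e f h)) (hc' : Commute x (casimir e' f' h')) (hh : Commute x h)
    (hh' : Commute x h') (hef : Commute x (e * f')) (hfe : Commute x (f * e')) :
    Commute x ((1/4 : ℂ) • (h - h')) ∧
      Commute x ((1/2 : ℂ) • casimir (e + e') (f + f') (h + h')) ∧
      Commute x (e * f' - f * e') := by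
  refine ⟨(hh.sub_right hh').smul_right _, ?_, hef.sub_right hfe⟩
  rw [p.casimir_add]
  exact (((hc.add_right hc').add_right ((hef.add_right hfe).smul_right _)).add_right
    (hh.mul_right hh')).smul_right _

theorem casimir_commute_generators (p : IsCommutingSl2Pair e f h e' f' h') :
    Commute (casimir e f h) ((1/4 : ℂ) • (h - h')) ∧
      Commute (casimir e f h) ((1/2 : ℂ) • casimir (e + e') (f + f') (h + h')) ∧
      Commute (casimir e f h) (e * f' - f * e') := by
  have c {x : R} := p.commute_casimir_left (x := x)
  have he := c (x := e) (by simp)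
  have hf := c (x := f) (by simp)
  have hh := c (x := h) (by simp)
  have he' := c (x := e') (by simp)
  have hf' := c (x := f') (by simp)
  have hh' := c (x := h') (by simp)
  exact p.commute_generators (.refl _)
    (((he'.mul_right hf').add_right (hf'.mul_right he')).add_right
      ((hh'.mul_right hh').smul_right _))
    hh hh' (he.mul_right hf') (hf.mul_right he')

theorem casimir_commute_generators' (p : IsCommutingSl2Pair e f h e' f' h') :
    Commute (casimir e' f' h') ((1/4 : ℂ) • (h - h')) ∧
      Commute (casimir e' f' h') ((1/2 : ℂ) • casimir (e + e') (f + f') (h + h')) ∧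
      Commute (casimir e' f' h') (e * f' - f * e') := by
  obtain ⟨h₁, h₂, h₃⟩ := p.symm.casimir_commute_generators
  refine ⟨?_, ?_, ?_⟩
  · convert h₁.neg_right using 1
    module
  · simpa only [add_comm] using h₂
  · convert h₃.neg_right using 1
    rw [p.ef, p.fe, neg_sub]

theorem weight_commute_generators (p : IsCommutingSl2Pair e f h e' f' h') :
    Commute (h + h') ((1/4 : ℂ) • (h - h')) ∧
      Commute (h + h') ((1/2 : ℂ) • casimir (e + e') (f + f') (h + h')) ∧
      Commute (h + h') (e * f' - f * e') := by
  have hhh' : Commute h h' := p.hh.symm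
  refine p.commute_generators ?_ ?_ ?_ ?_ ?_ ?_
  · exact (p.commute_casimir_left (by simp)).symm.add_left
      (p.commute_casimir_left (by simp)).symm
  · exact (p.symm.commute_casimir_left (by simp)).symm.add_left
      (p.symm.commute_casimir_left (by simp)).symm
  · exact (Commute.refl h).add_left hhh'.symm
  · exact hhh'.add_left (.refl h')
  · simp only [Commute, SemiconjBy, mul_add, add_mul, mul_assoc, mul_sub, two_mul,
      p.right.hf, p.left.he_assoc, p.fh, left_comm_of_mul_eq p.he]
    module
  · simp only [Commute, SemiconjBy, mul_add, add_mul, mul_assoc, two_mul, p.right.he,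
      p.left.hf_assoc, p.eh, left_comm_of_mul_eq p.hf]
    module

theorem commute_alpha {x : R} {k k' d : R} (hk : Commute k x) (hk' : Commute k' x)
    (hd : Commute d x) : Commute ((1/2 : ℂ) • (k + k') + (1/8 : ℂ) • (d * d)) x :=
  ((hk.add_left hk').smul_left _).add_left ((hd.mul_left hd).smul_left _)

theorem commute_beta {x : R} {k k' d : R} (hk : Commute k x) (hk' : Commute k' x)
    (hd : Commute d x) : Commute ((1/2 : ℂ) • ((k - k') * d)) x :=
  ((hk.sub_left hk').mul_left hd).smul_left _

end IsCommutingSl2Pair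

theorem isSl2Rel_U : IsSl2Rel UE UF UH where
  he := by
    have := RingQuot.mkAlgHom_rel ℂ URel.HE
    simp only [map_sub, map_mul, map_ofNat, sub_eq_iff_eq_add'] at this
    exact this
  hf := by
    have := RingQuot.mkAlgHom_rel ℂ URel.HF
    simp only [map_sub, map_mul, map_neg, map_ofNat, sub_eq_iff_eq_add', ← sub_eq_add_neg] at this
    exact this
  fe := by
    have := RingQuot.mkAlgHom_rel ℂ URel.EF
    simp only [map_sub, map_mul] at this
    exact (sub_eq_of_eq_add' (sub_eq_iff_eq_add.mp this)).symm

/-- The two tensor factors of `U(sl₂) ⊗ U(sl₂)` form commuting copies of `sl₂`. -/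
theorem isCommutingSl2Pair_tensor :
    IsCommutingSl2Pair (UE ⊗ₜ[ℂ] (1 : Usl2)) (UF ⊗ₜ[ℂ] (1 : Usl2)) (UH ⊗ₜ[ℂ] (1 : Usl2))
      ((1 : Usl2) ⊗ₜ[ℂ] UE) ((1 : Usl2) ⊗ₜ[ℂ] UF) ((1 : Usl2) ⊗ₜ[ℂ] UH) where
  left := isSl2Rel_U.map (R := Usl2 ⊗[ℂ] Usl2) (S := Usl2)
    (Algebra.TensorProduct.includeLeft : Usl2 →ₐ[ℂ] Usl2 ⊗[ℂ] Usl2)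
  right := isSl2Rel_U.map (R := Usl2 ⊗[ℂ] Usl2) (S := Usl2)
    (Algebra.TensorProduct.includeRight : Usl2 →ₐ[ℂ] Usl2 ⊗[ℂ] Usl2)
  ee := by simp
  ef := by simp
  eh := by simp
  fe := by simp
  ff := by simp
  fh := by simp
  he := by simp
  hf := by simp
  hh := by simp

theorem map_casimir {R : Type*} [Ring R] [Algebra ℂ R] (φ : Usl2 →ₐ[ℂ] R) :
    φ Casimir = IsSl2Rel.casimir (φ UE) (φ UF) (φ UH) := by
  simp [Casimir, IsSl2Rel.casimir]

theorem casimir_tmul_one : Casimir ⊗ₜ[ℂ] (1 : Usl2) =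
    IsSl2Rel.casimir (UE ⊗ₜ[ℂ] (1 : Usl2)) (UF ⊗ₜ[ℂ] (1 : Usl2)) (UH ⊗ₜ[ℂ] (1 : Usl2)) :=
  map_casimir (R := Usl2 ⊗[ℂ] Usl2)
    (Algebra.TensorProduct.includeLeft : Usl2 →ₐ[ℂ] Usl2 ⊗[ℂ] Usl2)

theorem one_tmul_casimir : (1 : Usl2) ⊗ₜ[ℂ] Casimir =
    IsSl2Rel.casimir ((1 : Usl2) ⊗ₜ[ℂ] UE) ((1 : Usl2) ⊗ₜ[ℂ] UF) ((1 : Usl2) ⊗ₜ[ℂ] UH) :=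
  map_casimir (R := Usl2 ⊗[ℂ] Usl2)
    (Algebra.TensorProduct.includeRight : Usl2 →ₐ[ℂ] Usl2 ⊗[ℂ] Usl2)

/-- The universal property of the Hahn algebra. -/
theorem exists_hahnAlg_algHom {R : Type*} [Ring R] [Algebra ℂ R] {a b c α β : R}
    (hc : a * b - b * a = c)
    (hα : (c * a - a * c) + 2 * (a * a) + b = α)
    (hβ : (b * c - c * b) + 4 * (b * a) + 2 * c = β)
    (hα_comm : Commute α a ∧ Commute α b ∧ Commute α c)
    (hβ_comm : Commute β a ∧ Commute β b ∧ Commute β c) :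
    ∃ φ : HahnAlg →ₐ[ℂ] R, φ HA = a ∧ φ HB = b ∧ φ HC = c := by
  let g : FreeAlgebra ℂ HGen →ₐ[ℂ] R := FreeAlgebra.lift ℂ fun | .A => a | .B => b | .C => c
  have ga : g fA = a := FreeAlgebra.lift_ι_apply _ _
  have gb : g fB = b := FreeAlgebra.lift_ι_apply _ _
  have gc : g fC = c := FreeAlgebra.lift_ι_apply _ _
  have gα : g fAlpha = α := by
    rw [← hα]; simp only [fAlpha, map_add, map_sub, map_mul, map_ofNat g, ga, gb, gc]
  have gβ : g fBeta = β := by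
    rw [← hβ]; simp only [fBeta, map_add, map_sub, map_mul, map_ofNat g, ga, gb, gc]
  have hg ⦃x y⦄ (hxy : HRel x y) : g x = g y := by
    cases hxy <;> simp only [map_sub, map_mul, ga, gb, gc, gα, gβ]
    exacts [hc, hα_comm.1, hα_comm.2.1, hα_comm.2.2, hβ_comm.1, hβ_comm.2.1, hβ_comm.2.2]
  have hlift (x) : RingQuot.liftAlgHom ℂ ⟨g, hg⟩ (RingQuot.mkAlgHom ℂ HRel x) = g x :=
    RingQuot.liftAlgHom_mkAlgHom_apply ..
  exact ⟨RingQuot.liftAlgHom ℂ ⟨g, hg⟩, (hlift _).trans ga, (hlift _).trans gb,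
    (hlift _).trans gc⟩

theorem hahnAlg_algHom_ext {R : Type*} [Ring R] [Algebra ℂ R] {φ ψ : HahnAlg →ₐ[ℂ] R}
    (hA : φ HA = ψ HA) (hB : φ HB = ψ HB) (hC : φ HC = ψ HC) : φ = ψ := by
  refine RingQuot.ringQuot_ext' ℂ _ _ (FreeAlgebra.hom_ext (funext fun x => ?_))
  cases x
  exacts [hA, hB, hC]

/-- Theorem 1.6: there is a unique algebra homomorphism `♮ : ℋ → U(sl₂) ⊗ U(sl₂)` with
`♮(A) = (H⊗1 - 1⊗H)/4`, `♮(B) = Δ(Λ)/2`, `♮(C) = E⊗F - F⊗E`; moreover `♮` sends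
`α ↦ (Λ⊗1 + 1⊗Λ)/2 + Δ(H)²/8` and `β ↦ ((Λ⊗1 - 1⊗Λ)Δ(H))/2`. -/
theorem existsUnique_naturalHom
    (Δ : Usl2 →ₐ[ℂ] Usl2 ⊗[ℂ] Usl2)
    (hΔE : Δ UE = UE ⊗ₜ[ℂ] 1 + 1 ⊗ₜ[ℂ] UE)
    (hΔF : Δ UF = UF ⊗ₜ[ℂ] 1 + 1 ⊗ₜ[ℂ] UF)
    (hΔH : Δ UH = UH ⊗ₜ[ℂ] 1 + 1 ⊗ₜ[ℂ] UH) :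
    (∃! nat : HahnAlg →ₐ[ℂ] Usl2 ⊗[ℂ] Usl2,
      nat HA = (1/4 : ℂ) • (UH ⊗ₜ[ℂ] 1 - 1 ⊗ₜ[ℂ] UH) ∧
      nat HB = (1/2 : ℂ) • Δ Casimir ∧
      nat HC = UE ⊗ₜ[ℂ] UF - UF ⊗ₜ[ℂ] UE) ∧
    (∀ nat : HahnAlg →ₐ[ℂ] Usl2 ⊗[ℂ] Usl2,
      nat HA = (1/4 : ℂ) • (UH ⊗ₜ[ℂ] 1 - 1 ⊗ₜ[ℂ] UH) →
      nat HB = (1/2 : ℂ) • Δ Casimir →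
      nat HC = UE ⊗ₜ[ℂ] UF - UF ⊗ₜ[ℂ] UE →
      nat hahnAlpha = (1/2 : ℂ) • (Casimir ⊗ₜ[ℂ] 1 + 1 ⊗ₜ[ℂ] Casimir) +
          (1/8 : ℂ) • (Δ UH * Δ UH) ∧
      nat hahnBeta = (1/2 : ℂ) • ((Casimir ⊗ₜ[ℂ] 1 - 1 ⊗ₜ[ℂ] Casimir) * Δ UH)) := by
  have p := isCommutingSl2Pair_tensor
  have hC : UE ⊗ₜ[ℂ] UF - UF ⊗ₜ[ℂ] UE =
      UE ⊗ₜ[ℂ] (1 : Usl2) * (1 : Usl2) ⊗ₜ[ℂ] UF - UF ⊗ₜ[ℂ] (1 : Usl2) * (1 : Usl2) ⊗ₜ[ℂ] UE := by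
    simp
  rw [hC, map_casimir (R := Usl2 ⊗[ℂ] Usl2) Δ, casimir_tmul_one, one_tmul_casimir, hΔE, hΔF, hΔH]
  obtain ⟨k₁, k₂, k₃⟩ := p.casimir_commute_generators
  obtain ⟨l₁, l₂, l₃⟩ := p.casimir_commute_generators'
  obtain ⟨w₁, w₂, w₃⟩ := p.weight_commute_generators
  constructor
  · obtain ⟨φ, hφ⟩ := exists_hahnAlg_algHom p.commutator_diff_casimir p.alpha_eq p.beta_eq
      ⟨IsCommutingSl2Pair.commute_alpha k₁ l₁ w₁,
        IsCommutingSl2Pair.commute_alpha k₂ l₂ w₂,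
        IsCommutingSl2Pair.commute_alpha k₃ l₃ w₃⟩
      ⟨IsCommutingSl2Pair.commute_beta k₁ l₁ w₁,
        IsCommutingSl2Pair.commute_beta k₂ l₂ w₂,
        IsCommutingSl2Pair.commute_beta k₃ l₃ w₃⟩
    exact ⟨φ, hφ, fun ψ hψ => hahnAlg_algHom_ext (R := Usl2 ⊗[ℂ] Usl2) (hψ.1.trans hφ.1.symm)
      (hψ.2.1.trans hφ.2.1.symm) (hψ.2.2.trans hφ.2.2.symm)⟩
  · intro φ hA hB hC
    constructor
    · rw [← p.alpha_eq]
      simp only [hahnAlpha, map_add, map_sub, map_mul, map_ofNat φ, hA, hB, hC]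
    · rw [← p.beta_eq]
      simp only [hahnBeta, map_add, map_sub, map_mul, map_ofNat φ, hA, hB, hC]
end
end

section
/- On the U(sl₂)-module ℂ^{2^Ω}, the Casimir element Λ acts by Λx = (D + (D−2|x|)²/2)·x + 2·Σ y, for every x∈2^Ω, where the sum is over all y∈2^Ω with |y|=|x| and x∩y ⋖ x. -/
open scoped TensorProduct
open scoped Classical

noncomputable section
/-- The relation `EF = FE + H` in `U(sl₂)`. -/
lemma UE_mul_UF : UE * UF = UF * UE + UH := by
  have h := RingQuot.mkAlgHom_rel ℂ URel.EF
  simp only [map_sub, map_mul] at h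
  exact sub_eq_iff_eq_add'.mp h

/-- The Casimir element rewritten as `2FE + H + H²/2`. -/
lemma Casimir_eq : Casimir = (2 : ℂ) • (UF * UE) + UH + (1/2 : ℂ) • (UH * UH) := by
  rw [Casimir, UE_mul_UF, two_smul]
  abel

lemma Finset.covBy_iff_subset_and_card {α : Type*} {s t : Finset α} :
    s ⋖ t ↔ s ⊆ t ∧ t.card = s.card + 1 := by
  rw [Finset.covBy_iff_card_sdiff_eq_one]
  refine and_congr_right fun h => ?_
  have := Finset.card_sdiff_add_card_eq_card h
  omega

lemma Finset.card_filter_covBy {α : Type*} [Fintype α] (x : Finset α) :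
    (Finset.univ.filter (fun z : Finset α => z ⋖ x)).card = x.card := by
  have h : Finset.univ.filter (fun z : Finset α => z ⋖ x) = x.image x.erase := by
    ext z
    simp [Finset.covBy_iff_exists_erase]
  rw [h, Finset.card_image_of_injOn (Finset.erase_injOn x)]

/-- Two distinct sets have at most one common lower cover, namely their intersection. -/
lemma Finset.covBy_and_covBy_iff {α : Type*} [DecidableEq α] {x y z : Finset α} (hxy : y ≠ x) :
    z ⋖ x ∧ z ⋖ y ↔ z = x ∩ y ∧ y.card = x.card ∧ (x ∩ y) ⋖ x := by
  simp only [Finset.covBy_iff_subset_and_card]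
  constructor
  · rintro ⟨⟨hzx, hx⟩, hzy, hy⟩
    have hsub : z ⊆ x ∩ y := Finset.subset_inter hzx hzy
    have hcard : (x ∩ y).card ≤ z.card := by
      by_contra! hlt
      have h₁ : x ∩ y = x := Finset.eq_of_subset_of_card_le Finset.inter_subset_left (by omega)
      have h₂ : x ∩ y = y := Finset.eq_of_subset_of_card_le Finset.inter_subset_right (by omega)
      exact hxy (h₂.symm.trans h₁)
    have hz := Finset.eq_of_subset_of_card_le hsub hcard
    exact ⟨hz, by omega, Finset.inter_subset_left, hz ▸ hx⟩
  · rintro ⟨rfl, hc, hs, hx⟩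
    exact ⟨⟨hs, hx⟩, Finset.inter_subset_right, by omega⟩

/-- Going down one step in the cube and then up one step. -/
lemma sum_covBy_sum_covBy {Ω : Type*} [Fintype Ω] [DecidableEq Ω] {M : Type*} [AddCommMonoid M]
    (f : Finset Ω → M) (x : Finset Ω) :
    ∑ z ∈ Finset.univ.filter (fun z : Finset Ω => z ⋖ x),
        ∑ y ∈ Finset.univ.filter (fun y : Finset Ω => z ⋖ y), f y =
      x.card • f x + ∑ y ∈ Finset.univ.filter
        (fun y : Finset Ω => y.card = x.card ∧ (x ∩ y) ⋖ x), f y := by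
  have hswap : ∑ z ∈ Finset.univ.filter (fun z : Finset Ω => z ⋖ x),
        ∑ y ∈ Finset.univ.filter (fun y : Finset Ω => z ⋖ y), f y =
      ∑ y, (Finset.univ.filter (fun z : Finset Ω => z ⋖ x ∧ z ⋖ y)).card • f y := by
    simp_rw [← Finset.sum_const, Finset.sum_filter]
    rw [Finset.sum_comm]
    refine Finset.sum_congr rfl fun z _ => ?_
    by_cases hz : z ⋖ x <;> simp [hz]
  have hcoeff (y : Finset Ω) :
      (Finset.univ.filter (fun z : Finset Ω => z ⋖ x ∧ z ⋖ y)).card • f y =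
        (if y = x then x.card • f x else 0) +
          if y.card = x.card ∧ (x ∩ y) ⋖ x then f y else 0 := by
    by_cases hy : y = x
    · subst hy
      simp [Finset.card_filter_covBy]
    · simp only [Finset.covBy_and_covBy_iff hy]
      by_cases h : y.card = x.card ∧ (x ∩ y) ⋖ x
      · simp [h, hy, Finset.filter_eq']
      · simp [h, hy]
  rw [hswap, Finset.sum_congr rfl fun y _ => hcoeff y, Finset.sum_add_distrib,
    ← Finset.sum_filter (p := fun y : Finset Ω => y.card = x.card ∧ (x ∩ y) ⋖ x)]
  simp

/-- Lemma 5.2: the action of the Casimir element `Λ` on the `U(sl₂)`-module `ℂ^{2^Ω}`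
(whose module structure, from Theorem 5.1, is hypothesized via the formulas `hE`, `hF`,
`hH` on the basis vectors `Pi.single x 1` for `x ∈ 2^Ω`). -/
theorem casimir_action_on_cube {Ω : Type} [Fintype Ω] [DecidableEq Ω]
    (ρ : Usl2 →ₐ[ℂ] Module.End ℂ (Finset Ω → ℂ))
    (hE : ∀ x : Finset Ω, ρ UE (Pi.single x 1) =
      ∑ y ∈ Finset.univ.filter (fun y : Finset Ω => y ⋖ x), (Pi.single y 1 : Finset Ω → ℂ))
    (hF : ∀ x : Finset Ω, ρ UF (Pi.single x 1) =
      ∑ y ∈ Finset.univ.filter (fun y : Finset Ω => x ⋖ y), (Pi.single y 1 : Finset Ω → ℂ))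
    (hH : ∀ x : Finset Ω, ρ UH (Pi.single x 1) =
      ((Fintype.card Ω : ℂ) - 2 * (x.card : ℂ)) • (Pi.single x 1 : Finset Ω → ℂ)) :
    ∀ x : Finset Ω, ρ Casimir (Pi.single x 1) =
      ((Fintype.card Ω : ℂ) + ((Fintype.card Ω : ℂ) - 2 * (x.card : ℂ))^2 / 2) •
          (Pi.single x 1 : Finset Ω → ℂ) +
      (2 : ℂ) • ∑ y ∈ Finset.univ.filter
          (fun y : Finset Ω => y.card = x.card ∧ (x ∩ y) ⋖ x), (Pi.single y 1 : Finset Ω → ℂ) := by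
  intro x
  have hFE : ρ (UF * UE) (Pi.single x 1) = x.card • (Pi.single x 1 : Finset Ω → ℂ) +
      ∑ y ∈ Finset.univ.filter
        (fun y : Finset Ω => y.card = x.card ∧ (x ∩ y) ⋖ x), (Pi.single y 1 : Finset Ω → ℂ) := by
    rw [map_mul, Module.End.mul_apply, hE, map_sum, Finset.sum_congr rfl fun z _ => hF z]
    exact sum_covBy_sum_covBy _ x
  have hHH : ρ (UH * UH) (Pi.single x 1) =
      ((Fintype.card Ω : ℂ) - 2 * (x.card : ℂ)) ^ 2 • (Pi.single x 1 : Finset Ω → ℂ) := by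
    rw [map_mul, Module.End.mul_apply, hH, map_smul, hH, smul_smul, sq]
  rw [Casimir_eq, map_add, map_add, map_smul, map_smul, LinearMap.add_apply, LinearMap.add_apply,
    LinearMap.smul_apply, LinearMap.smul_apply, hFE, hHH, hH]
  module
end
end

section
/- For all ℓ,n∈ℕ: s_ℓ(n) = (1/2)·C(n+1, ℓ+1) + (1/4)·Σ_{i=0}^{ℓ−1} (−1/2)^i · C(n+1, ℓ−i) + c, where c = (−1)^ℓ/2^{ℓ+1} if n is even and c = 0 if n is odd. Consequently, s_ℓ(n) equals the ceiling of (1/2)·C(n+1,ℓ+1) + (1/4)·Σ_{i=0}^{ℓ−1}(−1/2)^i·C(n+1,ℓ−i) when ℓ is even, and the floor of that quantity when ℓ is odd. -/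
/-- `s_ℓ(n) = Σ_{i=0}^{⌊n/2⌋} C(n-2i, ℓ)`. -/
def sSum (ℓ n : ℕ) : ℕ := ∑ i ∈ Finset.range (n/2 + 1), (n - 2*i).choose ℓ

/-- The alternating weighted sum `Σ_{i<ℓ} (-1/2)^i C(N, ℓ-i)`. -/
def altChooseSum (ℓ N : ℕ) : ℚ :=
  ∑ i ∈ Finset.range ℓ, (-1/2 : ℚ)^i * (N.choose (ℓ-i))

theorem altChooseSum_zero_left (N : ℕ) : altChooseSum 0 N = 0 := by
  simp [altChooseSum]

theorem altChooseSum_succ (ℓ N : ℕ) :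
    altChooseSum (ℓ+1) N = N.choose (ℓ+1) - (1/2) * altChooseSum ℓ N := by
  unfold altChooseSum
  rw [Finset.sum_range_succ', Finset.mul_sum, add_comm, sub_eq_add_neg, ← Finset.sum_neg_distrib]
  congr 1
  · simp
  · refine Finset.sum_congr rfl fun i _ => ?_
    rw [Nat.add_sub_add_right, pow_succ]
    ring

theorem altChooseSum_zero_right (ℓ : ℕ) : altChooseSum ℓ 0 = 0 := by
  induction ℓ with
  | zero => exact altChooseSum_zero_left 0
  | succ ℓ ih => simp [altChooseSum_succ, ih]

theorem altChooseSum_one_right (ℓ : ℕ) : altChooseSum (ℓ+1) 1 = (-1/2 : ℚ)^ℓ := by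
  induction ℓ with
  | zero => simp [altChooseSum_succ, altChooseSum_zero_left]
  | succ ℓ ih =>
    rw [altChooseSum_succ, ih, Nat.choose_eq_zero_of_lt (by lia), pow_succ]
    push_cast
    ring

theorem altChooseSum_add_two (ℓ N : ℕ) :
    altChooseSum ℓ (N+2) =
      altChooseSum ℓ N + 2 * ((N+1).choose ℓ) - 2 * (N.choose ℓ) := by
  induction ℓ with
  | zero => simp [altChooseSum_zero_left]
  | succ ℓ ih =>
    rw [altChooseSum_succ, altChooseSum_succ, ih, Nat.choose_succ_succ' (N+1),
      Nat.choose_succ_succ' N]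
    push_cast
    ring

theorem sSum_add_two (ℓ n : ℕ) : sSum ℓ (n+2) = sSum ℓ n + (n+2).choose ℓ := by
  unfold sSum
  rw [show (n+2)/2 + 1 = (n/2 + 1) + 1 by lia, Finset.sum_range_succ']
  congr 1
  refine Finset.sum_congr rfl fun i _ => ?_
  congr 1
  lia

theorem sSum_eq_altChooseSum (ℓ n : ℕ) :
    (sSum ℓ n : ℚ) = (1/2) * ((n+1).choose (ℓ+1)) + (1/4) * altChooseSum ℓ (n+1) +
      (if Even n then (-1 : ℚ)^ℓ / 2^(ℓ+1) else 0) := by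
  induction n using Nat.twoStepInduction with
  | zero =>
    cases ℓ with
    | zero => norm_num [sSum, altChooseSum_zero_left]
    | succ ℓ =>
      rw [altChooseSum_one_right, Nat.choose_eq_zero_of_lt (by lia), div_pow]
      simp only [sSum, Even.zero, if_true]
      simp
      field_simp
      ring
  | one =>
    rw [altChooseSum_add_two, altChooseSum_zero_right, Nat.choose_succ_succ' 1,
      Nat.choose_succ_succ' 0]
    simp [sSum]
    ring
  | more n ih _ =>
    rw [sSum_add_two, show n + 2 + 1 = n + 1 + 2 by ring, altChooseSum_add_two,
      Nat.choose_succ_succ' (n+2), Nat.choose_succ_succ' (n+1) ℓ]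
    push_cast
    rw [ih]
    simp only [Nat.even_add, even_two, iff_true]
    ring

/-- Lemma 6.2: the closed formula for `s_ℓ(n)`, and its expression as a ceiling (for `ℓ`
even) or floor (for `ℓ` odd). -/
theorem sSum_closed_formula (ℓ n : ℕ) :
    (sSum ℓ n : ℚ) = (1/2) * ((n+1).choose (ℓ+1)) +
      (1/4) * ∑ i ∈ Finset.range ℓ, (-1/2 : ℚ)^i * ((n+1).choose (ℓ-i)) +
      (if Even n then (-1 : ℚ)^ℓ / 2^(ℓ+1) else 0) ∧
    (sSum ℓ n : ℤ) =
      (if Even ℓ then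
        ⌈(1/2 : ℚ) * ((n+1).choose (ℓ+1)) +
          (1/4) * ∑ i ∈ Finset.range ℓ, (-1/2 : ℚ)^i * ((n+1).choose (ℓ-i))⌉
      else
        ⌊(1/2 : ℚ) * ((n+1).choose (ℓ+1)) +
          (1/4) * ∑ i ∈ Finset.range ℓ, (-1/2 : ℚ)^i * ((n+1).choose (ℓ-i))⌋) := by
  have h := sSum_eq_altChooseSum ℓ n
  refine ⟨h, ?_⟩
  change _ = if Even ℓ then ⌈(1/2 : ℚ) * ((n+1).choose (ℓ+1)) + (1/4) * altChooseSum ℓ (n+1)⌉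
    else ⌊(1/2 : ℚ) * ((n+1).choose (ℓ+1)) + (1/4) * altChooseSum ℓ (n+1)⌋
  have hpos : (0 : ℚ) < 1 / 2^(ℓ+1) := by positivity
  have hlt : (1 : ℚ) / 2^(ℓ+1) < 1 := by
    rw [div_lt_one (by positivity)]
    exact one_lt_pow₀ (by norm_num) (by lia)
  split_ifs with hl
  · rw [hl.neg_one_pow] at h
    symm
    rw [Int.ceil_eq_iff]
    push_cast
    split_ifs at h <;> constructor <;> linarith
  · rw [(Nat.not_even_iff_odd.mp hl).neg_one_pow, neg_div] at h
    symm
    rw [Int.floor_eq_iff]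
    push_cast
    split_ifs at h <;> constructor <;> linarith
end

section
/- Let D ≥ 2, let k be an integer with 1 ≤ k ≤ D−1, and let x₀ be a k-element subset of Ω. Then the dimension of the Terwilliger algebra 𝐓(x₀) of J(D,k) equals: (i) C(k+3,4) + ⌊(1/2)C(k+4,4) + (1/4)C(k+4,3) − (1/8)C(k+4,2) + (1/16)C(k+4,1)⌋ if 1 ≤ k < D/3; (ii) the quantity in (i) minus ⌊(1/2)C(3k−D+3,4) + (1/4)C(3k−D+3,3) − (1/8)C(3k−D+3,2) + (1/16)C(3k−D+3,1)⌋ if D/3 ≤ k < D/2; (iii) ⌊(1/2)C(D/2+4,4) + (1/4)C(D/2+4,3) − (1/8)C(D/2+4,2) + (1/16)C(D/2+4,1)⌋ if k = D/2; (iv) C(D−k+3,4) + ⌊(1/2)C(D−k+4,4) + (1/4)C(D−k+4,3) − (1/8)C(D−k+4,2) + (1/16)C(D−k+4,1)⌋ − ⌊(1/2)C(2D−3k+3,4) + (1/4)C(2D−3k+3,3) − (1/8)C(2D−3k+3,2) + (1/16)C(2D−3k+3,1)⌋ if D/2 < k ≤ 2D/3; (v) C(D−k+3,4) + ⌊(1/2)C(D−k+4,4)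 + (1/4)C(D−k+4,3) − (1/8)C(D−k+4,2) + (1/16)C(D−k+4,1)⌋ if 2D/3 < k ≤ D−1. Here C(·,·) denotes the binomial coefficient and ⌊·⌋ the floor function. -/
open scoped TensorProduct
open scoped Classical

noncomputable section
/-- The adjacency operator `𝐀` of the Johnson graph `J(D,k)`:
`𝐀 x = Σ_{|y| = |x|, x∩y ⋖ x} y`. -/
def johnsonAdj (Ω : Type) [Fintype Ω] [DecidableEq Ω] (k : ℕ) :
    Module.End ℂ ({s : Finset Ω // s.card = k} → ℂ) :=
  Matrix.toLin' (Matrix.of fun x y : {s : Finset Ω // s.card = k} =>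
    if ((x : Finset Ω) ∩ (y : Finset Ω)) ⋖ (x : Finset Ω) then (1 : ℂ) else 0)

/-- The dual adjacency operator `𝐀*(x₀)` of `J(D,k)` with respect to the vertex `x₀`:
`𝐀*(x₀) x = (D-1)(1 - D(|x₀∖x|+|x∖x₀|)/(2k(D-k))) x`. -/
def johnsonDualAdj {Ω : Type} [Fintype Ω] [DecidableEq Ω] (x₀ : Finset Ω) (k : ℕ) :
    Module.End ℂ ({s : Finset Ω // s.card = k} → ℂ) :=
  Matrix.toLin' (Matrix.diagonal fun x : {s : Finset Ω // s.card = k} =>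
    ((Fintype.card Ω : ℂ) - 1) *
      (1 - (Fintype.card Ω : ℂ) *
            (((x₀ \ (x : Finset Ω)).card : ℂ) + (((x : Finset Ω) \ x₀).card : ℂ)) /
          (2 * (k : ℂ) * ((Fintype.card Ω : ℂ) - (k : ℂ)))))

/-- The Terwilliger algebra `𝐓(x₀)` of `J(D,k)` with respect to `x₀`: the subalgebra of
`End(ℂ^{(Ω choose k)})` generated by `𝐀` and `𝐀*(x₀)`. -/
def terwilliger {Ω : Type} [Fintype Ω] [DecidableEq Ω] (x₀ : Finset Ω) (k : ℕ) :
    Subalgebra ℂ (Module.End ℂ ({s : Finset Ω // s.card = k} → ℂ)) :=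
  Algebra.adjoin ℂ {johnsonAdj Ω k, johnsonDualAdj x₀ k}
/-- The quantity `(1/2)C(n,4) + (1/4)C(n,3) - (1/8)C(n,2) + (1/16)C(n,1)`. -/
def qTerm (n : ℕ) : ℚ :=
  (1/2) * (n.choose 4) + (1/4) * (n.choose 3) - (1/8) * (n.choose 2) + (1/16) * (n.choose 1)

/-- A linear space of matrices which are constant on the classes of `cls`, and which contains for
every class a matrix supported on that class and classes of smaller `μ`-value, has dimension equal
to the number of classes. -/
theorem finrank_eq_card_classes {α ι β : Type*} [Fintype α] [DecidableEq ι] [Preorder β]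
    [WellFoundedLT β] (T : Submodule ℂ (Matrix α α ℂ)) (cls : α → α → ι)
    (hinv : ∀ M ∈ T, ∀ x y x' y', cls x y = cls x' y' → M x y = M x' y') (μ : ι → β)
    (hM : ∀ x y, ∃ M ∈ T, M x y ≠ 0 ∧
      ∀ x' y', M x' y' ≠ 0 → cls x' y' = cls x y ∨ μ (cls x' y') < μ (cls x y)) :
    Module.finrank ℂ T = (Finset.univ.image fun p : α × α => cls p.1 p.2).card := by
  set S : Finset ι := Finset.univ.image fun p : α × α => cls p.1 p.2 with hS
  have memS : ∀ x y, cls x y ∈ S := fun x y =>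
    Finset.mem_image.2 ⟨(x, y), Finset.mem_univ _, rfl⟩
  let ind : ι → Matrix α α ℂ := fun c => Matrix.of fun x y => if cls x y = c then 1 else 0
  have hsum : ∀ M ∈ T, ∀ v : ι → ℂ, (∀ x y, v (cls x y) = M x y) →
      M = ∑ c ∈ S, v c • ind c := by
    intro M _ v hv
    ext x y
    simp [ind, Matrix.sum_apply, ← hv, memS]
  have hind : ∀ b : β, ∀ x y, μ (cls x y) = b → ind (cls x y) ∈ T := by
    intro b
    induction b using WellFoundedLT.induction with
    | ind b ih =>
      rintro x y rfl
      obtain ⟨M, hMT, hne, hsupp⟩ := hM x y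
      have : ∃ v : ι → ℂ, ∀ x y, v (cls x y) = M x y := by
        refine ⟨fun c => if h : ∃ p : α × α, cls p.1 p.2 = c then M h.choose.1 h.choose.2 else 0,
          fun x y => ?_⟩
        have h : ∃ p : α × α, cls p.1 p.2 = cls x y := ⟨(x, y), rfl⟩
        simp only [h, dif_pos]
        exact hinv M hMT _ _ _ _ h.choose_spec
      obtain ⟨v, hv⟩ := this
      have hdec := hsum M hMT v hv
      rw [← Finset.add_sum_erase S _ (memS x y), hv] at hdec
      have hrest : ∑ c ∈ S.erase (cls x y), v c • ind c ∈ T := by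
        refine Submodule.sum_mem _ fun c hc => ?_
        obtain ⟨hc1, hc2⟩ := Finset.mem_erase.1 hc
        obtain ⟨⟨x', y'⟩, -, rfl⟩ := Finset.mem_image.1 hc2
        by_cases h0 : M x' y' = 0
        · simp [hv, h0]
        · rcases hsupp x' y' h0 with h | h
          · exact absurd h hc1
          · exact T.smul_mem _ (ih _ h x' y' rfl)
      have : ind (cls x y) = (M x y)⁻¹ • (M - ∑ c ∈ S.erase (cls x y), v c • ind c) := by
        rw [eq_inv_smul_iff₀ hne, eq_sub_iff_add_eq]
        exact hdec.symm
      rw [this]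
      exact T.smul_mem _ (T.sub_mem hMT hrest)
  let φ : (S → ℂ) →ₗ[ℂ] Matrix α α ℂ :=
    { toFun := fun v => Matrix.of fun x y => v ⟨cls x y, memS x y⟩
      map_add' := fun _ _ => rfl
      map_smul' := fun _ _ => rfl }
  have hφ : Function.Injective φ := by
    intro v w h
    ext ⟨c, hc⟩
    obtain ⟨⟨x, y⟩, -, rfl⟩ := Finset.mem_image.1 hc
    exact congrFun (congrFun h x) y
  have hT : T = LinearMap.range φ := by
    apply le_antisymm
    · intro M hMT
      have : ∃ v : S → ℂ, ∀ x y, v ⟨cls x y, memS x y⟩ = M x y := by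
        have h : ∀ c : S, ∃ p : α × α, cls p.1 p.2 = c := fun c => by
          obtain ⟨p, -, hp⟩ := Finset.mem_image.1 c.2
          exact ⟨p, hp⟩
        choose p hp using h
        exact ⟨fun c => M (p c).1 (p c).2, fun x y => hinv M hMT _ _ _ _ (hp ⟨cls x y, memS x y⟩)⟩
      obtain ⟨v, hv⟩ := this
      exact ⟨v, by ext x y; exact hv x y⟩
    · rintro _ ⟨v, rfl⟩
      have : φ v = ∑ c : S, v c • ind c := by
        ext x y
        simp only [Matrix.sum_apply, Matrix.smul_apply, ind, Matrix.of_apply, smul_eq_mul,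
          mul_ite, mul_one, mul_zero]
        rw [Finset.sum_eq_single ⟨cls x y, memS x y⟩]
        · rw [if_pos rfl]
          rfl
        · intro c _ hc
          rw [if_neg]
          rintro h
          exact hc (Subtype.ext h.symm)
        · simp
      rw [this]
      refine Submodule.sum_mem _ fun c _ => T.smul_mem _ ?_
      obtain ⟨c, hc⟩ := c
      obtain ⟨⟨x, y⟩, -, rfl⟩ := Finset.mem_image.1 hc
      exact hind _ x y rfl
  rw [hT, LinearMap.finrank_range_of_inj hφ]
  simp

section Johnson

set_option linter.unusedSectionVars false

variable {Ω : Type} [Fintype Ω] [DecidableEq Ω]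

/-- The `k`-element subsets of `Ω`. -/
abbrev KSubset (Ω : Type) (k : ℕ) : Type := {s : Finset Ω // s.card = k}

/-- The matrix with natural number entries whose `(x,y)` entry is `1` iff `y` arises from `x` by
removing an element of `B` and adding an element of `C`. -/
def swapMat (k : ℕ) (B C : Finset Ω) : Matrix (KSubset Ω k) (KSubset Ω k) ℕ :=
  Matrix.of fun x y => ∑ e ∈ B, ∑ f ∈ C, if x.1 \ y.1 = {e} ∧ y.1 \ x.1 = {f} then 1 else 0

/-- The complex matrix underlying a matrix with natural number entries. -/
def toC {V : Type} [Fintype V] [DecidableEq V] : Matrix V V ℕ →+* Matrix V V ℂ :=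
  (Nat.castRingHom ℂ).mapMatrix

lemma toC_apply {V : Type} [Fintype V] [DecidableEq V] (M : Matrix V V ℕ) (x y : V) :
    toC M x y = (M x y : ℂ) := rfl

lemma toC_apply_ne_zero {V : Type} [Fintype V] [DecidableEq V] (M : Matrix V V ℕ) (x y : V) :
    toC M x y ≠ 0 ↔ M x y ≠ 0 := by
  rw [toC_apply, Nat.cast_ne_zero]

lemma swapMat_ne_zero {k : ℕ} {B C : Finset Ω} {x y : KSubset Ω k} :
    swapMat k B C x y ≠ 0 ↔ ∃ e ∈ B, ∃ f ∈ C, x.1 \ y.1 = {e} ∧ y.1 \ x.1 = {f} := by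
  simp [swapMat, Finset.sum_eq_zero_iff]

lemma sdiff_eq_singleton_iff {x y : Finset Ω} {e f : Ω} :
    (x \ y = {e} ∧ y \ x = {f}) ↔ (e ∈ x ∧ f ∉ x ∧ y = insert f (x.erase e)) := by
  constructor
  · rintro ⟨h1, h2⟩
    have he : e ∈ x \ y := by simp [h1]
    have hf : f ∈ y \ x := by simp [h2]
    simp only [Finset.mem_sdiff] at he hf
    refine ⟨he.1, hf.2, ?_⟩
    ext a
    have h1a := Finset.ext_iff.1 h1 a
    have h2a := Finset.ext_iff.1 h2 a
    simp only [Finset.mem_sdiff, Finset.mem_singleton, Finset.mem_insert, Finset.mem_erase] at *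
    by_cases a = f <;> by_cases a = e <;> grind
  · rintro ⟨he, hf, rfl⟩
    constructor <;> ext a <;> simp only [Finset.mem_sdiff, Finset.mem_singleton,
      Finset.mem_insert, Finset.mem_erase] <;> grind

lemma card_sdiff_comm' {k : ℕ} (x y : KSubset Ω k) : (x.1 \ y.1).card = (y.1 \ x.1).card := by
  have h1 := Finset.card_sdiff_add_card_inter x.1 y.1
  have h2 := Finset.card_sdiff_add_card_inter y.1 x.1
  rw [Finset.inter_comm] at h2
  have := x.2
  have := y.2
  omega

lemma inter_covBy_iff (x y : Finset Ω) : x ∩ y ⋖ x ↔ (x \ y).card = 1 := by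
  have h := Finset.card_sdiff_add_card_inter x y
  rw [Finset.covBy_iff_card_sdiff_eq_one]
  simp

/-! ### Raising and lowering operators on functions on the power set -/

/-- The operator `g ↦ (x ↦ g (x ∖ {e}))`, where the value is `0` if `e ∉ x`. -/
def eOp (e : Ω) : Module.End ℂ (Finset Ω → ℂ) where
  toFun g x := if e ∈ x then g (x.erase e) else 0
  map_add' g h := by ext x; by_cases hx : e ∈ x <;> simp [hx]
  map_smul' c g := by ext x; by_cases hx : e ∈ x <;> simp [hx]

/-- The operator `g ↦ (x ↦ g (x ∪ {e}))`, where the value is `0` if `e ∈ x`. -/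
def iOp (e : Ω) : Module.End ℂ (Finset Ω → ℂ) where
  toFun g x := if e ∈ x then 0 else g (insert e x)
  map_add' g h := by ext x; by_cases hx : e ∈ x <;> simp [hx]
  map_smul' c g := by ext x; by_cases hx : e ∈ x <;> simp [hx]

lemma eOp_apply (e : Ω) (g : Finset Ω → ℂ) (x : Finset Ω) :
    eOp e g x = if e ∈ x then g (x.erase e) else 0 := rfl

lemma iOp_apply (e : Ω) (g : Finset Ω → ℂ) (x : Finset Ω) :
    iOp e g x = if e ∈ x then 0 else g (insert e x) := rfl

lemma eOp_comm (e f : Ω) : eOp e * eOp f = eOp f * eOp e := by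
  refine LinearMap.ext fun g => funext fun x => ?_
  simp only [Module.End.mul_apply, eOp_apply, Finset.mem_erase, Finset.erase_right_comm (a := e)]
  grind

lemma iOp_comm (e f : Ω) : iOp e * iOp f = iOp f * iOp e := by
  refine LinearMap.ext fun g => funext fun x => ?_
  simp only [Module.End.mul_apply, iOp_apply, Finset.mem_insert, Finset.insert_comm e f]
  grind

lemma eOp_iOp_comm {e f : Ω} (h : e ≠ f) : eOp e * iOp f = iOp f * eOp e := by
  refine LinearMap.ext fun g => funext fun x => ?_
  simp only [Module.End.mul_apply, iOp_apply, eOp_apply, Finset.mem_insert, Finset.mem_erase,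
    Finset.erase_insert_of_ne h.symm]
  grind

/-- Multiplication by the number of elements in `B`. -/
def nOp (B : Finset Ω) : Module.End ℂ (Finset Ω → ℂ) where
  toFun g x := ((x ∩ B).card : ℂ) * g x
  map_add' g h := by ext x; simp [mul_add]
  map_smul' c g := by ext x; simp; ring

lemma nOp_apply (B : Finset Ω) (g : Finset Ω → ℂ) (x : Finset Ω) :
    nOp B g x = ((x ∩ B).card : ℂ) * g x := rfl

lemma sum_eOp_mul_iOp_self (B : Finset Ω) : ∑ e ∈ B, eOp e * iOp e = nOp B := by
  refine LinearMap.ext fun g => funext fun x => ?_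
  have : ∀ e, (eOp e * iOp e) g x = if e ∈ x then g x else 0 := by
    intro e
    simp only [Module.End.mul_apply, iOp_apply, eOp_apply]
    by_cases h : e ∈ x <;> simp [h]
  simp only [LinearMap.sum_apply, Finset.sum_apply, this, nOp_apply]
  rw [← Finset.sum_filter, Finset.sum_const, nsmul_eq_mul, Finset.filter_mem_eq_inter,
    Finset.inter_comm]

lemma sum_iOp_mul_eOp_self (B : Finset Ω) :
    ∑ e ∈ B, iOp e * eOp e = (B.card : Module.End ℂ (Finset Ω → ℂ)) - nOp B := by
  rw [eq_sub_iff_add_eq, ← sum_eOp_mul_iOp_self, ← Finset.sum_add_distrib,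
    ← nsmul_one, ← Finset.sum_const]
  refine Finset.sum_congr rfl fun e _ => ?_
  refine LinearMap.ext fun g => funext fun x => ?_
  simp only [LinearMap.add_apply, Pi.add_apply, Module.End.mul_apply, iOp_apply, eOp_apply]
  by_cases h : e ∈ x <;> simp [h]

/-- Sum of `eOp e` over `e ∈ B`. -/
def eSum (B : Finset Ω) : Module.End ℂ (Finset Ω → ℂ) := ∑ e ∈ B, eOp e

/-- Sum of `iOp e` over `e ∈ B`. -/
def iSum (B : Finset Ω) : Module.End ℂ (Finset Ω → ℂ) := ∑ e ∈ B, iOp e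

lemma eSum_comm (B C : Finset Ω) : eSum B * eSum C = eSum C * eSum B := by
  simp only [eSum, Finset.sum_mul_sum]
  rw [Finset.sum_comm]
  exact Finset.sum_congr rfl fun _ _ => Finset.sum_congr rfl fun _ _ => eOp_comm _ _

lemma iSum_comm (B C : Finset Ω) : iSum B * iSum C = iSum C * iSum B := by
  simp only [iSum, Finset.sum_mul_sum]
  rw [Finset.sum_comm]
  exact Finset.sum_congr rfl fun _ _ => Finset.sum_congr rfl fun _ _ => iOp_comm _ _

lemma eSum_iSum_comm {B C : Finset Ω} (h : Disjoint B C) :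
    eSum B * iSum C = iSum C * eSum B := by
  simp only [eSum, iSum, Finset.sum_mul_sum]
  rw [Finset.sum_comm]
  refine Finset.sum_congr rfl fun f hf => Finset.sum_congr rfl fun e he => eOp_iOp_comm ?_
  rintro rfl
  exact Finset.disjoint_left.1 h he hf

lemma iSum_mul_eSum_self (B : Finset Ω) :
    iSum B * eSum B = eSum B * iSum B + (B.card : Module.End ℂ (Finset Ω → ℂ)) - 2 * nOp B := by
  have h1 : iSum B * eSum B = ∑ e ∈ B, iOp e * eOp e +
      ∑ e ∈ B, ∑ f ∈ B.erase e, iOp e * eOp f := by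
    simp only [eSum, iSum, Finset.sum_mul_sum]
    rw [← Finset.sum_add_distrib]
    exact Finset.sum_congr rfl fun e he => (Finset.add_sum_erase _ _ he).symm
  have h2 : eSum B * iSum B = ∑ e ∈ B, eOp e * iOp e +
      ∑ e ∈ B, ∑ f ∈ B.erase e, iOp e * eOp f := by
    simp only [eSum, iSum, Finset.sum_mul_sum]
    rw [Finset.sum_comm, ← Finset.sum_add_distrib]
    refine Finset.sum_congr rfl fun e he => ?_
    rw [← Finset.add_sum_erase _ _ he]
    congr 1
    exact Finset.sum_congr rfl fun f hf => eOp_iOp_comm (Finset.ne_of_mem_erase hf)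
  rw [h1, h2, sum_eOp_mul_iOp_self, sum_iOp_mul_eOp_self, two_mul]
  abel

/-! ### Matrices representing operators -/

/-- A matrix indexed by the `k`-subsets represents an operator on functions on the power set if it
computes the restriction of the image of a function from the restriction of the function. -/
def Represents {k : ℕ} (M : Matrix (KSubset Ω k) (KSubset Ω k) ℂ)
    (X : Module.End ℂ (Finset Ω → ℂ)) : Prop :=
  ∀ g : Finset Ω → ℂ, M.mulVec (fun y => g y.1) = fun x => X g x.1

namespace Represents

variable {k : ℕ} {M N : Matrix (KSubset Ω k) (KSubset Ω k) ℂ} {X Y : Module.End ℂ (Finset Ω → ℂ)}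

lemma add (hM : Represents M X) (hN : Represents N Y) : Represents (M + N) (X + Y) := by
  intro g
  rw [Matrix.add_mulVec, hM, hN]
  rfl

lemma sub (hM : Represents M X) (hN : Represents N Y) : Represents (M - N) (X - Y) := by
  intro g
  rw [Matrix.sub_mulVec, hM, hN]
  rfl

lemma mul (hM : Represents M X) (hN : Represents N Y) : Represents (M * N) (X * Y) := by
  intro g
  rw [← Matrix.mulVec_mulVec, hN, hM]
  rfl

lemma sum {ι : Type*} {s : Finset ι} {M : ι → Matrix (KSubset Ω k) (KSubset Ω k) ℂ}
    {X : ι → Module.End ℂ (Finset Ω → ℂ)} (h : ∀ i ∈ s, Represents (M i) (X i)) :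
    Represents (∑ i ∈ s, M i) (∑ i ∈ s, X i) := by
  intro g
  rw [Matrix.sum_mulVec, Finset.sum_congr rfl fun i hi => h i hi g]
  ext x
  simp

lemma unique (hM : Represents M X) (hN : Represents N X) : M = N := by
  refine Matrix.ext_of_mulVec_single fun y => ?_
  have : (Pi.single y (1 : ℂ) : KSubset Ω k → ℂ) = fun z => (Pi.single y.1 (1 : ℂ) :
      Finset Ω → ℂ) z.1 := by
    ext z
    simp only [Pi.single_apply, Subtype.ext_iff]
  rw [this, hM, hN]

lemma diagonal (φ : Finset Ω → ℂ) (h : ∀ g x, x.card = k → X g x = φ x * g x) :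
    Represents (Matrix.diagonal fun x : KSubset Ω k => φ x.1) X := by
  intro g
  ext x
  rw [Matrix.mulVec_diagonal, h g x.1 x.2]

lemma swap {e f : Ω} (h : e ≠ f) :
    Represents (Matrix.of fun x y : KSubset Ω k =>
      if x.1 \ y.1 = {e} ∧ y.1 \ x.1 = {f} then (1 : ℂ) else 0) (eOp e * iOp f) := by
  intro g
  ext x
  simp only [Matrix.mulVec, dotProduct, Matrix.of_apply, Module.End.mul_apply, eOp_apply,
    iOp_apply, sdiff_eq_singleton_iff, Finset.mem_erase, h.symm, ne_eq,
    not_false_eq_true, true_and]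
  by_cases he : e ∈ x.1
  · by_cases hf : f ∈ x.1
    · simp [he, hf]
    · have hc : (insert f (x.1.erase e)).card = k := by
        rw [Finset.card_insert_of_notMem (by simp [hf]), Finset.card_erase_add_one he, x.2]
      rw [Finset.sum_eq_single ⟨_, hc⟩]
      · simp [he, hf]
      · intro y _ hy
        rw [if_neg, zero_mul]
        rintro ⟨-, -, h⟩
        exact hy (Subtype.ext h)
      · simp
  · simp [he]

end Represents

lemma toC_swapMat (k : ℕ) (B C : Finset Ω) : toC (swapMat k B C) = ∑ e ∈ B, ∑ f ∈ C,
    Matrix.of fun x y : KSubset Ω k =>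
      if x.1 \ y.1 = {e} ∧ y.1 \ x.1 = {f} then (1 : ℂ) else 0 := by
  ext x y
  simp [toC_apply, swapMat, Matrix.sum_apply]

lemma represents_swapMat_of_disjoint {k : ℕ} {B C : Finset Ω} (h : Disjoint B C) :
    Represents (toC (swapMat k B C)) (eSum B * iSum C) := by
  rw [toC_swapMat, eSum, iSum, Finset.sum_mul_sum]
  refine .sum fun e he => .sum fun f hf => .swap ?_
  rintro rfl
  exact Finset.disjoint_left.1 h he hf

lemma represents_swapMat_self {k : ℕ} (B : Finset Ω) :
    Represents (toC (swapMat k B B)) (eSum B * iSum B - nOp B) := by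
  have h2 : eSum B * iSum B = ∑ e ∈ B, ∑ f ∈ B.erase e, eOp e * iOp f +
      ∑ e ∈ B, eOp e * iOp e := by
    simp only [eSum, iSum, Finset.sum_mul_sum]
    rw [← Finset.sum_add_distrib]
    exact Finset.sum_congr rfl fun e he => (Finset.sum_erase_add _ _ he).symm
  rw [h2, sum_eOp_mul_iOp_self, add_sub_cancel_right, toC_swapMat]
  refine .sum fun e he => ?_
  rw [← Finset.add_sum_erase _ _ he]
  have h0 : (Matrix.of fun x y : KSubset Ω k =>
      if x.1 \ y.1 = {e} ∧ y.1 \ x.1 = {e} then (1 : ℂ) else 0) = 0 := by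
    ext x y
    simp only [Matrix.of_apply, Matrix.zero_apply, ite_eq_right_iff, one_ne_zero, imp_false,
      sdiff_eq_singleton_iff]
    rintro ⟨h1, h2, -⟩
    exact h2 h1
  rw [h0, zero_add]
  exact .sum fun f hf => .swap (Finset.ne_of_mem_erase hf).symm

/-- The distance of `x` to `x₀` in the Johnson graph. -/
def lev {k : ℕ} (x₀ : Finset Ω) (x : KSubset Ω k) : ℕ := (x.1 \ x₀).card

/-- Diagonal matrix of a function of the level. -/
def levDiag {k : ℕ} (x₀ : Finset Ω) (φ : ℕ → ℂ) : Matrix (KSubset Ω k) (KSubset Ω k) ℂ :=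
  Matrix.diagonal fun x => φ (lev x₀ x)

lemma represents_nOp_compl {k : ℕ} (x₀ : Finset Ω) :
    Represents (levDiag (k := k) x₀ fun i => (i : ℂ)) (nOp x₀ᶜ) :=
  .diagonal (fun x => ((x \ x₀).card : ℂ)) fun g x _ => by
    rw [nOp_apply, Finset.sdiff_eq_inter_compl]

lemma represents_nOp {k : ℕ} (x₀ : Finset Ω) :
    Represents (levDiag (k := k) x₀ fun i => (k : ℂ) - i) (nOp x₀) :=
  .diagonal (fun x => (k : ℂ) - ((x \ x₀).card : ℂ)) fun g x hx => by
    rw [nOp_apply, ← hx, ← Finset.card_sdiff_add_card_inter x x₀]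
    push_cast
    ring

lemma represents_const {k : ℕ} (x₀ : Finset Ω) (c : ℕ) :
    Represents (levDiag (k := k) x₀ fun _ => (c : ℂ)) (c : Module.End ℂ (Finset Ω → ℂ)) :=
  .diagonal (fun _ => (c : ℂ)) fun g x _ => by
    rw [Module.End.natCast_apply, Pi.smul_apply, nsmul_eq_mul]

/-- `LR = (A₁ + k - H)(A₂ + (D - k) - H)`. -/
lemma lower_mul_raise {k : ℕ} (x₀ : Finset Ω) :
    toC (swapMat k x₀ x₀ᶜ) * toC (swapMat k x₀ᶜ x₀) =
      (toC (swapMat k x₀ x₀) + levDiag x₀ fun i => (k : ℂ) - i) *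
        (toC (swapMat k x₀ᶜ x₀ᶜ) + levDiag x₀ fun i => ((x₀ᶜ.card : ℕ) : ℂ) - i) := by
  have hd : Disjoint x₀ x₀ᶜ := disjoint_compl_right
  refine ((represents_swapMat_of_disjoint hd).mul (represents_swapMat_of_disjoint hd.symm)).unique
    ?_
  have e1 : (levDiag (k := k) x₀ fun i => ((x₀ᶜ.card : ℕ) : ℂ) - i) =
      levDiag x₀ (fun _ => ((x₀ᶜ.card : ℕ) : ℂ)) - levDiag x₀ fun i => (i : ℂ) := by
    simp [levDiag, Matrix.diagonal_sub]
  have key : eSum x₀ * iSum x₀ᶜ * (eSum x₀ᶜ * iSum x₀) =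
      (eSum x₀ * iSum x₀ - nOp x₀ + nOp x₀) *
        (eSum x₀ᶜ * iSum x₀ᶜ - nOp x₀ᶜ + ((x₀ᶜ.card : ℕ) - nOp x₀ᶜ)) := by
    have h1 : eSum x₀ᶜ * iSum x₀ᶜ - nOp x₀ᶜ + ((x₀ᶜ.card : ℕ) - nOp x₀ᶜ) =
        iSum x₀ᶜ * eSum x₀ᶜ := by
      rw [iSum_mul_eSum_self, two_mul]
      abel
    rw [h1, sub_add_cancel, mul_assoc, mul_assoc]
    congr 1
    rw [eSum_iSum_comm hd.symm, ← mul_assoc, iSum_comm, mul_assoc]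
  rw [key, e1]
  exact ((represents_swapMat_self _).add (represents_nOp _)).mul
    ((represents_swapMat_self _).add ((represents_const _ _).sub (represents_nOp_compl _)))

/-- `RL = (A₁ + H)(A₂ + H)`. -/
lemma raise_mul_lower {k : ℕ} {x₀ : Finset Ω} (hx₀ : x₀.card = k) :
    toC (swapMat k x₀ᶜ x₀) * toC (swapMat k x₀ x₀ᶜ) =
      (toC (swapMat k x₀ x₀) + levDiag x₀ fun i => (i : ℂ)) *
        (toC (swapMat k x₀ᶜ x₀ᶜ) + levDiag x₀ fun i => (i : ℂ)) := by
  have hd : Disjoint x₀ x₀ᶜ := disjoint_compl_right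
  refine ((represents_swapMat_of_disjoint hd.symm).mul (represents_swapMat_of_disjoint hd)).unique
    ?_
  have e1 : (levDiag (k := k) x₀ fun i => (i : ℂ)) =
      levDiag x₀ (fun _ => ((x₀.card : ℕ) : ℂ)) - levDiag x₀ fun i => ((k : ℂ) - i) := by
    rw [levDiag, levDiag, levDiag, Matrix.diagonal_sub]
    congr 1
    funext x
    rw [hx₀, sub_sub_cancel]
  have key : eSum x₀ᶜ * iSum x₀ * (eSum x₀ * iSum x₀ᶜ) =
      (eSum x₀ * iSum x₀ - nOp x₀ + ((x₀.card : ℕ) - nOp x₀)) *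
        (eSum x₀ᶜ * iSum x₀ᶜ - nOp x₀ᶜ + nOp x₀ᶜ) := by
    have h1 : eSum x₀ * iSum x₀ - nOp x₀ + ((x₀.card : ℕ) - nOp x₀) =
        iSum x₀ * eSum x₀ := by
      rw [iSum_mul_eSum_self, two_mul]
      abel
    rw [h1, sub_add_cancel, ← mul_assoc, ← mul_assoc]
    congr 1
    rw [eSum_iSum_comm hd.symm, mul_assoc, eSum_comm, mul_assoc]
  rw [key]
  nth_rw 1 [e1]
  exact ((represents_swapMat_self _).add ((represents_const _ _).sub (represents_nOp _))).mul
    ((represents_swapMat_self _).add (represents_nOp_compl _))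

/-! ### The matrix form of the Terwilliger algebra -/

/-- The adjacency matrix of the Johnson graph. -/
def adjMat (Ω : Type) [Fintype Ω] [DecidableEq Ω] (k : ℕ) :
    Matrix (KSubset Ω k) (KSubset Ω k) ℂ :=
  Matrix.of fun x y => if ((x : Finset Ω) ∩ (y : Finset Ω)) ⋖ (x : Finset Ω) then (1 : ℂ) else 0

/-- The dual adjacency matrix of the Johnson graph. -/
def dualMat (x₀ : Finset Ω) (k : ℕ) : Matrix (KSubset Ω k) (KSubset Ω k) ℂ :=
  Matrix.diagonal fun x : {s : Finset Ω // s.card = k} =>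
    ((Fintype.card Ω : ℂ) - 1) *
      (1 - (Fintype.card Ω : ℂ) *
            (((x₀ \ (x : Finset Ω)).card : ℂ) + (((x : Finset Ω) \ x₀).card : ℂ)) /
          (2 * (k : ℂ) * ((Fintype.card Ω : ℂ) - (k : ℂ))))

/-- The Terwilliger algebra as an algebra of matrices. -/
def terwMat (x₀ : Finset Ω) (k : ℕ) : Subalgebra ℂ (Matrix (KSubset Ω k) (KSubset Ω k) ℂ) :=
  Algebra.adjoin ℂ {adjMat Ω k, dualMat x₀ k}

lemma finrank_terwilliger (x₀ : Finset Ω) (k : ℕ) :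
    Module.finrank ℂ (terwilliger x₀ k) =
      Module.finrank ℂ (Subalgebra.toSubmodule (terwMat x₀ k)) := by
  have h : terwilliger x₀ k = (terwMat x₀ k).map
      (Matrix.toLinAlgEquiv' : Matrix (KSubset Ω k) (KSubset Ω k) ℂ ≃ₐ[ℂ] _).toAlgHom := by
    rw [terwMat, AlgHom.map_adjoin, Set.image_pair]
    rfl
  rw [h]
  exact (((terwMat x₀ k).equivMapOfInjective _
    (Matrix.toLinAlgEquiv' : Matrix (KSubset Ω k) (KSubset Ω k) ℂ ≃ₐ[ℂ] _).injective
      ).toLinearEquiv.finrank_eq).symm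

lemma lev_le {k : ℕ} (x₀ : Finset Ω) (x : KSubset Ω k) : lev x₀ x ≤ k :=
  (Finset.card_le_card Finset.sdiff_subset).trans x.2.le

lemma dualMat_eq {k : ℕ} {x₀ : Finset Ω} (hx₀ : x₀.card = k) :
    dualMat x₀ k = levDiag x₀ fun i => ((Fintype.card Ω : ℂ) - 1) *
      (1 - (Fintype.card Ω : ℂ) * ((i : ℂ) + i) /
          (2 * (k : ℂ) * ((Fintype.card Ω : ℂ) - (k : ℂ)))) := by
  unfold dualMat levDiag
  congr 1
  funext x
  rw [card_sdiff_comm' (⟨x₀, hx₀⟩ : KSubset Ω k) x]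
  rfl

/-- `levDiag` as an algebra homomorphism. -/
def levDiagHom {k : ℕ} (x₀ : Finset Ω) : (ℕ → ℂ) →ₐ[ℂ] Matrix (KSubset Ω k) (KSubset Ω k) ℂ :=
  (Matrix.diagonalAlgHom ℂ).comp
    (AlgHom.pi fun x : KSubset Ω k => Pi.evalAlgHom ℂ (fun _ : ℕ => ℂ) (lev x₀ x))

lemma levDiagHom_apply {k : ℕ} (x₀ : Finset Ω) (φ : ℕ → ℂ) :
    levDiagHom (k := k) x₀ φ = levDiag x₀ φ := rfl

lemma levDiag_mem_of_injective {k : ℕ} {x₀ : Finset Ω}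
    {T : Subalgebra ℂ (Matrix (KSubset Ω k) (KSubset Ω k) ℂ)} {ψ : ℕ → ℂ}
    (hψ : Function.Injective ψ) (h : levDiag x₀ ψ ∈ T) (φ : ℕ → ℂ) : levDiag x₀ φ ∈ T := by
  have h2 : Polynomial.aeval (levDiag (k := k) x₀ ψ)
      (Lagrange.interpolate (Finset.range (k + 1)) ψ φ) = levDiag x₀ φ := by
    rw [← levDiagHom_apply, Polynomial.aeval_algHom_apply, levDiagHom_apply]
    unfold levDiag
    congr 1
    funext x
    have h3 := Lagrange.eval_interpolate_at_node (s := Finset.range (k + 1)) φ (v := ψ)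
      hψ.injOn (Finset.mem_range.2 (Nat.lt_succ_of_le (lev_le x₀ x)))
    rw [← h3]
    have h4 := Polynomial.aeval_algHom_apply (Pi.evalAlgHom ℂ (fun _ : ℕ => ℂ) (lev x₀ x)) ψ
      (Lagrange.interpolate (Finset.range (k + 1)) ψ φ)
    rw [Pi.evalAlgHom_apply, Pi.evalAlgHom_apply] at h4
    rw [← h4, Polynomial.coe_aeval_eq_eval]
  rw [← h2]
  exact Algebra.adjoin_le (Set.singleton_subset_iff.2 h)
    (Polynomial.aeval_mem_adjoin_singleton ℂ _)

lemma levDiag_mem {k : ℕ} {x₀ : Finset Ω} (hx₀ : x₀.card = k) (hD : 2 ≤ Fintype.card Ω)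
    (hk1 : 1 ≤ k) (hk2 : k < Fintype.card Ω) (φ : ℕ → ℂ) : levDiag x₀ φ ∈ terwMat x₀ k := by
  have h : dualMat x₀ k ∈ terwMat x₀ k := Algebra.subset_adjoin (Set.mem_insert_of_mem _ rfl)
  rw [dualMat_eq hx₀] at h
  refine levDiag_mem_of_injective ?_ h φ
  intro i j hij
  have h1 : (Fintype.card Ω : ℂ) - 1 ≠ 0 := by
    rw [sub_ne_zero]
    exact_mod_cast (by omega : Fintype.card Ω ≠ 1)
  have h2 : (Fintype.card Ω : ℂ) - k ≠ 0 := by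
    rw [sub_ne_zero]
    exact_mod_cast hk2.ne'
  have h3 : (Fintype.card Ω : ℂ) ≠ 0 := by exact_mod_cast (by omega : Fintype.card Ω ≠ 0)
  have h4 : (k : ℂ) ≠ 0 := by exact_mod_cast (by omega : k ≠ 0)
  have h5 := sub_right_injective (mul_left_cancel₀ h1 hij)
  rw [div_left_inj' (by simp [h2, h4])] at h5
  have h6 := mul_left_cancel₀ h3 h5
  rw [← two_mul, ← two_mul] at h6
  exact_mod_cast mul_left_cancel₀ two_ne_zero h6

/-- An algebra containing the level projections is closed under scaling entries by functions of
the levels. -/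
lemma scale_mem {k : ℕ} {x₀ : Finset Ω} {T : Subalgebra ℂ (Matrix (KSubset Ω k) (KSubset Ω k) ℂ)}
    (h : ∀ φ, levDiag x₀ φ ∈ T) {M : Matrix (KSubset Ω k) (KSubset Ω k) ℂ} (hM : M ∈ T)
    (φ : ℕ → ℕ → ℂ) : (Matrix.of fun x y => φ (lev x₀ x) (lev x₀ y) * M x y) ∈ T := by
  have : (Matrix.of fun x y => φ (lev x₀ x) (lev x₀ y) * M x y) =
      ∑ i ∈ Finset.range (k + 1), levDiag x₀ (fun j => if j = i then 1 else 0) * M *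
        levDiag x₀ (fun j => φ i j) := by
    ext x y
    simp only [levDiag, Matrix.sum_apply, Matrix.of_apply, Matrix.mul_diagonal,
      Matrix.diagonal_mul, ite_mul, one_mul, zero_mul, Finset.sum_ite_eq, Finset.mem_range,
      Nat.lt_succ_of_le (lev_le x₀ x), if_true]
    ring
  rw [this]
  exact sum_mem fun i _ => mul_mem (mul_mem (h _) hM) (h _)

lemma swapMat_apply {k : ℕ} (B C : Finset Ω) {x y : KSubset Ω k} {e f : Ω}
    (h : x.1 \ y.1 = {e} ∧ y.1 \ x.1 = {f}) :
    swapMat k B C x y = if e ∈ B ∧ f ∈ C then 1 else 0 := by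
  simp only [swapMat, Matrix.of_apply, h.1, h.2, Finset.singleton_inj]
  by_cases he : e ∈ B <;> by_cases hf : f ∈ C <;> simp [he, hf, ite_and]

lemma swapMat_eq_zero {k : ℕ} (B C : Finset Ω) {x y : KSubset Ω k}
    (h : ¬ ∃ e f, x.1 \ y.1 = {e} ∧ y.1 \ x.1 = {f}) : swapMat k B C x y = 0 := by
  by_contra h0
  obtain ⟨e, -, f, -, h1⟩ := swapMat_ne_zero.1 h0
  exact h ⟨e, f, h1⟩

lemma adjMat_apply {k : ℕ} (x y : KSubset Ω k) :
    adjMat Ω k x y = if ∃ e f, x.1 \ y.1 = {e} ∧ y.1 \ x.1 = {f} then 1 else 0 := by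
  rw [adjMat, Matrix.of_apply]
  congr 1
  rw [inter_covBy_iff, eq_iff_iff]
  constructor
  · intro h
    obtain ⟨e, he⟩ := Finset.card_eq_one.1 h
    obtain ⟨f, hf⟩ := Finset.card_eq_one.1 ((card_sdiff_comm' x y).symm.trans h)
    exact ⟨e, f, he, hf⟩
  · rintro ⟨e, f, he, -⟩
    simp [he]

lemma card_sdiff_inter {x y : Finset Ω} {e : Ω} (x₀ : Finset Ω) (h : x \ y = {e}) :
    (x \ x₀).card = ((x ∩ y) \ x₀).card + if e ∈ x₀ then 0 else 1 := by
  have h1 : x \ x₀ = ((x ∩ y) \ x₀) ∪ ({e} \ x₀) := by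
    rw [← h]
    ext a
    simp only [Finset.mem_sdiff, Finset.mem_union, Finset.mem_inter]
    tauto
  have h2 : Disjoint ((x ∩ y) \ x₀) ({e} \ x₀) := by
    rw [← h, Finset.disjoint_left]
    intro a
    simp only [Finset.mem_sdiff, Finset.mem_inter]
    tauto
  rw [h1, Finset.card_union_of_disjoint h2]
  by_cases he : e ∈ x₀
  · simp [he]
  · have h3 : ({e} : Finset Ω) \ x₀ = {e} :=
      Finset.sdiff_eq_self_of_disjoint (Finset.disjoint_singleton_left.2 he)
    rw [if_neg he, h3, Finset.card_singleton]

lemma lev_add {k : ℕ} (x₀ : Finset Ω) {x y : KSubset Ω k} {e f : Ω}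
    (h : x.1 \ y.1 = {e} ∧ y.1 \ x.1 = {f}) :
    lev x₀ x + (if f ∈ x₀ then 0 else 1) = lev x₀ y + if e ∈ x₀ then 0 else 1 := by
  have h1 := card_sdiff_inter x₀ h.1
  have h2 := card_sdiff_inter x₀ h.2
  rw [Finset.inter_comm] at h2
  unfold lev
  omega

lemma swapMat_eq_scale {k : ℕ} {x₀ B C : Finset Ω} {φ : ℕ → ℕ → ℕ}
    (h : ∀ i j e f, i + (if f ∈ x₀ then 0 else 1) = j + (if e ∈ x₀ then 0 else 1) →
      φ i j = if e ∈ B ∧ f ∈ C then 1 else 0) :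
    toC (swapMat k B C) = Matrix.of fun x y => (φ (lev x₀ x) (lev x₀ y) : ℂ) * adjMat Ω k x y := by
  ext x y
  rw [Matrix.of_apply, adjMat_apply, toC_apply]
  by_cases hxy : ∃ e f, x.1 \ y.1 = {e} ∧ y.1 \ x.1 = {f}
  · rw [if_pos hxy]
    obtain ⟨e, f, hef⟩ := hxy
    rw [swapMat_apply B C hef, h _ _ e f (lev_add x₀ hef), mul_one]
  · rw [if_neg hxy, swapMat_eq_zero B C hxy, mul_zero, Nat.cast_zero]

lemma flat_eq_scale {k : ℕ} (x₀ : Finset Ω) :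
    toC (swapMat k x₀ x₀) + toC (swapMat k x₀ᶜ x₀ᶜ) = Matrix.of fun x y =>
      ((fun i j => if i = j then 1 else 0 : ℕ → ℕ → ℂ) (lev x₀ x) (lev x₀ y)) *
        adjMat Ω k x y := by
  ext x y
  rw [Matrix.of_apply, adjMat_apply, Matrix.add_apply, toC_apply, toC_apply]
  by_cases hxy : ∃ e f, x.1 \ y.1 = {e} ∧ y.1 \ x.1 = {f}
  · rw [if_pos hxy]
    obtain ⟨e, f, hef⟩ := hxy
    rw [swapMat_apply _ _ hef, swapMat_apply _ _ hef, mul_one]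
    have := lev_add x₀ hef
    by_cases he : e ∈ x₀ <;> by_cases hf : f ∈ x₀ <;> simp [he, hf] at this ⊢ <;> omega
  · rw [if_neg hxy, swapMat_eq_zero _ _ hxy, swapMat_eq_zero _ _ hxy]
    simp

section Membership

variable {k : ℕ} {x₀ : Finset Ω} {T : Subalgebra ℂ (Matrix (KSubset Ω k) (KSubset Ω k) ℂ)}

lemma raise_mem (h : ∀ φ, levDiag x₀ φ ∈ T) (hA : adjMat Ω k ∈ T) :
    toC (swapMat k x₀ᶜ x₀) ∈ T := by
  rw [swapMat_eq_scale (x₀ := x₀) (φ := fun i j => if i = j + 1 then 1 else 0)]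
  · exact scale_mem h hA fun i j => ((if i = j + 1 then 1 else 0 : ℕ) : ℂ)
  · intro i j e f hij
    by_cases he : e ∈ x₀ <;> by_cases hf : f ∈ x₀ <;> simp [he, hf] at hij ⊢ <;> omega

lemma lower_mem (h : ∀ φ, levDiag x₀ φ ∈ T) (hA : adjMat Ω k ∈ T) :
    toC (swapMat k x₀ x₀ᶜ) ∈ T := by
  rw [swapMat_eq_scale (x₀ := x₀) (φ := fun i j => if i + 1 = j then 1 else 0)]
  · exact scale_mem h hA fun i j => ((if i + 1 = j then 1 else 0 : ℕ) : ℂ)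
  · intro i j e f hij
    by_cases he : e ∈ x₀ <;> by_cases hf : f ∈ x₀ <;> simp [he, hf] at hij ⊢ <;> omega

lemma flat_mem (h : ∀ φ, levDiag x₀ φ ∈ T) (hA : adjMat Ω k ∈ T) :
    toC (swapMat k x₀ x₀) + toC (swapMat k x₀ᶜ x₀ᶜ) ∈ T := by
  rw [flat_eq_scale]
  exact scale_mem h hA fun i j => if i = j then 1 else 0

lemma swapMat_lev {B : Finset Ω} (hB : B = x₀ ∨ B = x₀ᶜ) {x y : KSubset Ω k}
    (h : swapMat k B B x y ≠ 0) : lev x₀ x = lev x₀ y := by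
  obtain ⟨e, he, f, hf, hef⟩ := swapMat_ne_zero.1 h
  have h1 := lev_add x₀ hef
  rcases hB with rfl | rfl
  · simp only [he, hf, if_true] at h1
    omega
  · rw [Finset.mem_compl] at he hf
    simp only [he, hf, if_false] at h1
    omega

lemma swapMat_comm_levDiag {B : Finset Ω} (hB : B = x₀ ∨ B = x₀ᶜ) (φ : ℕ → ℂ) :
    toC (swapMat k B B) * levDiag x₀ φ = levDiag x₀ φ * toC (swapMat k B B) := by
  ext x y
  rw [levDiag, Matrix.mul_diagonal, Matrix.diagonal_mul, mul_comm]
  by_cases h : swapMat k B B x y = 0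
  · rw [toC_apply, h]
    simp
  · rw [swapMat_lev hB h]

lemma inner_mul_outer_mem (hx₀ : x₀.card = k) (h : ∀ φ, levDiag x₀ φ ∈ T) (hA : adjMat Ω k ∈ T) :
    toC (swapMat k x₀ x₀) * toC (swapMat k x₀ᶜ x₀ᶜ) ∈ T := by
  have h1 := raise_mul_lower hx₀
  rw [add_mul, mul_add, mul_add, swapMat_comm_levDiag (Or.inl rfl)] at h1
  have h2 : toC (swapMat k x₀ x₀) * toC (swapMat k x₀ᶜ x₀ᶜ) =
      toC (swapMat k x₀ᶜ x₀) * toC (swapMat k x₀ x₀ᶜ) -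
      (levDiag x₀ fun i => (i : ℂ)) * (toC (swapMat k x₀ x₀) + toC (swapMat k x₀ᶜ x₀ᶜ)) -
      (levDiag x₀ fun i => (i : ℂ)) * (levDiag x₀ fun i => (i : ℂ)) := by
    rw [h1, mul_add]
    abel
  rw [h2]
  exact sub_mem (sub_mem (mul_mem (raise_mem h hA) (lower_mem h hA))
    (mul_mem (h _) (flat_mem h hA))) (mul_mem (h _) (h _))

lemma inner_mem (hx₀ : x₀.card = k) (hk : Fintype.card Ω ≠ 2 * k)
    (h : ∀ φ, levDiag x₀ φ ∈ T) (hA : adjMat Ω k ∈ T) : toC (swapMat k x₀ x₀) ∈ T := by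
  have h1 := lower_mul_raise (k := k) x₀
  set n : ℂ := ((x₀ᶜ.card : ℕ) : ℂ) with hn
  have hc : n - k ≠ 0 := by
    rw [hn, sub_ne_zero, Finset.card_compl, hx₀]
    have := Finset.card_le_univ x₀
    exact_mod_cast (by omega : Fintype.card Ω - k ≠ k)
  set A₁ := toC (swapMat k x₀ x₀) with hA₁
  set A₂ := toC (swapMat k x₀ᶜ x₀ᶜ) with hA₂
  set P := levDiag (k := k) x₀ fun i => (k : ℂ) - i with hP
  set Q := levDiag (k := k) x₀ fun i => n - i with hQ
  have h2 : Q - P = (n - k) • 1 := by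
    ext x y
    rcases eq_or_ne x y with rfl | hxy
    · simp [hP, hQ, levDiag]
    · simp [hP, hQ, levDiag, hxy]
  have h3 : A₁ * Q = Q * A₁ := swapMat_comm_levDiag (Or.inl rfl) _
  have h4 : toC (swapMat k x₀ x₀ᶜ) * toC (swapMat k x₀ᶜ x₀) - A₁ * A₂ - P * (A₁ + A₂) - P * Q =
      (n - k) • A₁ := by
    rw [← one_mul A₁, ← smul_mul_assoc, ← h2, h1, add_mul, mul_add, mul_add, h3, one_mul,
      mul_add, sub_mul]
    abel
  have h5 : A₁ = (n - k)⁻¹ • ((n - k) • A₁) := by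
    rw [inv_smul_smul₀ hc]
  rw [h5, ← h4]
  exact T.smul_mem (sub_mem (sub_mem (sub_mem (mul_mem (lower_mem h hA) (raise_mem h hA))
    (inner_mul_outer_mem hx₀ h hA)) (mul_mem (h _) (flat_mem h hA))) (mul_mem (h _) (h _))) _

lemma outer_mem (hx₀ : x₀.card = k) (hk : Fintype.card Ω ≠ 2 * k)
    (h : ∀ φ, levDiag x₀ φ ∈ T) (hA : adjMat Ω k ∈ T) : toC (swapMat k x₀ᶜ x₀ᶜ) ∈ T := by
  have := sub_mem (flat_mem h hA) (inner_mem hx₀ hk h hA)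
  rwa [add_sub_cancel_left] at this

end Membership

/-- The Terwilliger algebra is closed under transposition. -/
lemma transpose_mem {k : ℕ} {x₀ : Finset Ω} {M : Matrix (KSubset Ω k) (KSubset Ω k) ℂ}
    (hM : M ∈ terwMat x₀ k) : M.transpose ∈ terwMat x₀ k := by
  induction hM using Algebra.adjoin_induction with
  | mem M hM =>
    rcases hM with rfl | rfl
    · have : (adjMat Ω k).transpose = adjMat Ω k := by
        ext x y
        rw [Matrix.transpose_apply, adjMat_apply, adjMat_apply]
        congr 1
        rw [exists_comm]
        simp only [and_comm]
      rw [this]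
      exact Algebra.subset_adjoin (Set.mem_insert _ _)
    · rw [dualMat, Matrix.diagonal_transpose]
      exact Algebra.subset_adjoin (Set.mem_insert_of_mem _ rfl)
  | algebraMap r =>
    rw [Matrix.algebraMap_eq_diagonal, Matrix.diagonal_transpose, ← Matrix.algebraMap_eq_diagonal]
    exact Subalgebra.algebraMap_mem _ _
  | add M N _ _ hM hN => exact add_mem hM hN
  | mul M N _ _ hM hN =>
    rw [Matrix.transpose_mul]
    exact mul_mem hN hM

/-! ### Orbits of the stabilizer of `x₀` -/

lemma apply_eq_of_automorphism {k : ℕ} {x₀ : Finset Ω} (hx₀ : x₀.card = k)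
    (g : KSubset Ω k → KSubset Ω k) (hg : Function.Injective g)
    (hadj : ∀ x y, ((g x).1 \ (g y).1).card = (x.1 \ y.1).card)
    (hlev : ∀ x, lev x₀ (g x) = lev x₀ x) {M : Matrix (KSubset Ω k) (KSubset Ω k) ℂ}
    (hM : M ∈ terwMat x₀ k) (x y : KSubset Ω k) : M (g x) (g y) = M x y := by
  induction hM using Algebra.adjoin_induction generalizing x y with
  | mem M hM =>
    rcases hM with rfl | rfl
    · simp only [adjMat, Matrix.of_apply, inter_covBy_iff, hadj]
    · rw [dualMat_eq hx₀, levDiag, Matrix.diagonal_apply, Matrix.diagonal_apply, hlev]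
      simp only [hg.eq_iff]
  | algebraMap r =>
    rw [Matrix.algebraMap_eq_diagonal, Matrix.diagonal_apply, Matrix.diagonal_apply]
    simp [hg.eq_iff]
  | add M N _ _ hM hN => rw [Matrix.add_apply, Matrix.add_apply, hM, hN]
  | mul M N _ _ hM hN =>
    rw [Matrix.mul_apply, Matrix.mul_apply,
      ← (Equiv.ofBijective g (Finite.injective_iff_bijective.1 hg)).sum_comp]
    exact Finset.sum_congr rfl fun z _ => congrArg₂ _ (hM x z) (hN z y)

/-- The number of elements of `x₀` which belong to `x` but not to `y`. -/
def dIn {k : ℕ} (x₀ : Finset Ω) (x y : KSubset Ω k) : ℕ := ((x.1 ∩ x₀) \ y.1).card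

/-- The number of elements outside of `x₀` which belong to `y` but not to `x`. -/
def dOut {k : ℕ} (x₀ : Finset Ω) (x y : KSubset Ω k) : ℕ := ((y.1 \ x₀) \ x.1).card

/-- The membership pattern of an element. -/
def pattern (s t u : Finset Ω) (a : Ω) : Bool × Bool × Bool :=
  (decide (a ∈ s), decide (a ∈ t), decide (a ∈ u))

/-- The number of elements with a given membership pattern. -/
def patternCard (s t u : Finset Ω) (c : Bool × Bool × Bool) : ℕ :=
  Fintype.card {a // pattern s t u a = c}

lemma card_eq_sum_pattern {s t u : Finset Ω} (v : Finset Ω) (p : Bool × Bool × Bool → Bool)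
    (h : ∀ a, a ∈ v ↔ p (pattern s t u a) = true) :
    v.card = ∑ c, if p c = true then patternCard s t u c else 0 := by
  rw [Finset.card_eq_sum_card_fiberwise (f := pattern s t u) (t := Finset.univ)
    (by intro a _; simp)]
  refine Finset.sum_congr rfl fun c _ => ?_
  rw [patternCard, Fintype.card_subtype]
  by_cases hc : p c = true
  · rw [if_pos hc]
    congr 1
    ext a
    simp only [Finset.mem_filter, Finset.mem_univ, true_and, and_iff_right_iff_imp, h]
    rintro rfl
    exact hc
  · rw [if_neg hc, Finset.card_eq_zero, Finset.filter_eq_empty_iff]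
    rintro a ha rfl
    exact hc ((h a).1 ha)

lemma exists_perm_of_card_eq {k : ℕ} {x₀ : Finset Ω} {x y x' y' : KSubset Ω k}
    (hx : lev x₀ x = lev x₀ x') (hy : lev x₀ y = lev x₀ y')
    (hi : dIn x₀ x y = dIn x₀ x' y') (ho : dOut x₀ x y = dOut x₀ x' y') :
    ∃ σ : Equiv.Perm Ω, (∀ a, σ a ∈ x₀ ↔ a ∈ x₀) ∧ (∀ a, σ a ∈ x'.1 ↔ a ∈ x.1) ∧
      ∀ a, σ a ∈ y'.1 ↔ a ∈ y.1 := by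
  have hcard : ∀ c, patternCard x₀ x.1 y.1 c = patternCard x₀ x'.1 y'.1 c := by
    have hk : ∀ x y : KSubset Ω k, _ ∧ _ ∧ _ ∧ _ ∧ _ ∧ _ ∧ _ ∧ _ := fun x y =>
      ⟨card_eq_sum_pattern (s := x₀) (t := x.1) (u := y.1) (x.1 \ x₀) (fun c => c.2.1 && !c.1)
        (by simp [pattern]),
      card_eq_sum_pattern (s := x₀) (t := x.1) (u := y.1) (y.1 \ x₀) (fun c => c.2.2 && !c.1)
        (by simp [pattern]),
      card_eq_sum_pattern (s := x₀) (t := x.1) (u := y.1) ((x.1 ∩ x₀) \ y.1)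
        (fun c => (c.2.1 && c.1) && !c.2.2) (by simp [pattern]),
      card_eq_sum_pattern (s := x₀) (t := x.1) (u := y.1) ((y.1 \ x₀) \ x.1)
        (fun c => (c.2.2 && !c.1) && !c.2.1) (by simp [pattern]),
      card_eq_sum_pattern (s := x₀) (t := x.1) (u := y.1) x.1 (fun c => c.2.1) (by simp [pattern]),
      card_eq_sum_pattern (s := x₀) (t := x.1) (u := y.1) y.1 (fun c => c.2.2) (by simp [pattern]),
      card_eq_sum_pattern (s := x₀) (t := x.1) (u := y.1) x₀ (fun c => c.1) (by simp [pattern]),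
      card_eq_sum_pattern (s := x₀) (t := x.1) (u := y.1) Finset.univ (fun _ => true) (by simp)⟩
    have h1 := hk x y
    have h2 := hk x' y'
    rw [x.2, y.2] at h1
    rw [x'.2, y'.2] at h2
    change lev x₀ x = _ ∧ lev x₀ y = _ ∧ dIn x₀ x y = _ ∧ dOut x₀ x y = _ ∧ _ at h1
    change lev x₀ x' = _ ∧ lev x₀ y' = _ ∧ dIn x₀ x' y' = _ ∧ dOut x₀ x' y' = _ ∧ _ at h2
    rw [hx, hy, hi, ho] at h1
    generalize patternCard x₀ x.1 y.1 = p at h1 ⊢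
    generalize patternCard x₀ x'.1 y'.1 = p' at h2 ⊢
    simp only [Fintype.sum_prod_type, Fintype.sum_bool, Bool.and_eq_true, Bool.not_true,
      Bool.not_false, Bool.false_eq_true, and_true, and_false, if_true, if_false, add_zero,
      zero_add] at h1 h2
    obtain ⟨a1, a2, a3, a4, a5, a6, a7, a8⟩ := h1
    obtain ⟨b1, b2, b3, b4, b5, b6, b7, b8⟩ := h2
    have c1 : p (true, true, false) = p' (true, true, false) := by omega
    have c2 : p (false, false, true) = p' (false, false, true) := by omega
    have c3 : p (false, true, true) = p' (false, true, true) := by omega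
    have c4 : p (false, true, false) = p' (false, true, false) := by omega
    have c5 : p (true, true, true) = p' (true, true, true) := by omega
    have c6 : p (true, false, true) = p' (true, false, true) := by omega
    have c7 : p (true, false, false) = p' (true, false, false) := by omega
    have c8 : p (false, false, false) = p' (false, false, false) := by omega
    rintro ⟨_ | _, _ | _, _ | _⟩ <;> assumption
  let e := Equiv.ofFiberEquiv fun c => Fintype.equivOfCardEq (hcard c)
  have he : ∀ a, pattern x₀ x'.1 y'.1 (e a) = pattern x₀ x.1 y.1 a :=
    Equiv.ofFiberEquiv_map _
  simp only [pattern, Prod.mk.injEq, decide_eq_decide] at he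
  exact ⟨e, fun a => (he a).1, fun a => (he a).2.1, fun a => (he a).2.2⟩

/-- The action of a permutation on `k`-subsets. -/
def permAct (k : ℕ) (σ : Equiv.Perm Ω) (x : KSubset Ω k) : KSubset Ω k :=
  ⟨x.1.map σ.toEmbedding, by rw [Finset.card_map, x.2]⟩

lemma permAct_injective (k : ℕ) (σ : Equiv.Perm Ω) : Function.Injective (permAct k σ) := by
  intro x y h
  exact Subtype.ext (Finset.map_injective _ (congrArg Subtype.val h))

lemma apply_eq_of_card_eq {k : ℕ} {x₀ : Finset Ω} (hx₀ : x₀.card = k) {x y x' y' : KSubset Ω k}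
    (hx : lev x₀ x = lev x₀ x') (hy : lev x₀ y = lev x₀ y')
    (hi : dIn x₀ x y = dIn x₀ x' y') (ho : dOut x₀ x y = dOut x₀ x' y')
    {M : Matrix (KSubset Ω k) (KSubset Ω k) ℂ} (hM : M ∈ terwMat x₀ k) :
    M x y = M x' y' := by
  obtain ⟨σ, h0, h1, h2⟩ := exists_perm_of_card_eq hx hy hi ho
  have hmap : ∀ s t : Finset Ω, (∀ a, σ a ∈ t ↔ a ∈ s) → s.map σ.toEmbedding = t := by
    intro s t h
    ext a
    obtain ⟨b, rfl⟩ := σ.surjective a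
    rw [h]
    simp
  have e1 : permAct k σ x = x' := Subtype.ext (hmap _ _ h1)
  have e2 : permAct k σ y = y' := Subtype.ext (hmap _ _ h2)
  rw [← e1, ← e2]
  refine (apply_eq_of_automorphism hx₀ _ (permAct_injective k σ) (fun x y => ?_) (fun x => ?_)
    hM x y).symm
  · rw [permAct, permAct, ← Finset.map_sdiff, Finset.card_map]
  · rw [lev, permAct]
    nth_rw 1 [← hmap _ _ h0]
    rw [← Finset.map_sdiff, Finset.card_map, lev]

/-- The invariants `(∂(x₀,x), ∂(x₀,y), a, b)` of a pair of vertices, where `a` and `b` measure how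
far `x` and `y` are from being nested inside and outside of `x₀`, respectively. -/
def cls {k : ℕ} (x₀ : Finset Ω) (x y : KSubset Ω k) : ℕ × ℕ × ℕ × ℕ :=
  if lev x₀ y ≤ lev x₀ x then (lev x₀ x, lev x₀ y, dIn x₀ x y, dOut x₀ x y)
  else (lev x₀ x, lev x₀ y, dIn x₀ y x, dOut x₀ y x)

lemma apply_eq_of_cls_eq {k : ℕ} {x₀ : Finset Ω} (hx₀ : x₀.card = k) {x y x' y' : KSubset Ω k}
    (h : cls x₀ x y = cls x₀ x' y') {M : Matrix (KSubset Ω k) (KSubset Ω k) ℂ}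
    (hM : M ∈ terwMat x₀ k) : M x y = M x' y' := by
  by_cases h1 : lev x₀ y ≤ lev x₀ x <;> by_cases h2 : lev x₀ y' ≤ lev x₀ x' <;>
    simp only [cls, h1, h2, if_true, if_false, Prod.mk.injEq] at h
  · exact apply_eq_of_card_eq hx₀ h.1 h.2.1 h.2.2.1 h.2.2.2 hM
  · omega
  · omega
  · exact apply_eq_of_card_eq hx₀ h.2.1 h.1 h.2.2.1 h.2.2.2 (transpose_mem hM)

/-- The two last invariants as an unordered pair. -/
def symCls {k : ℕ} (x₀ : Finset Ω) (x y : KSubset Ω k) : ℕ × ℕ × ℕ × ℕ :=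
  ((cls x₀ x y).1, (cls x₀ x y).2.1, min (cls x₀ x y).2.2.1 (cls x₀ x y).2.2.2,
    max (cls x₀ x y).2.2.1 (cls x₀ x y).2.2.2)

lemma exists_swap_automorphism {k : ℕ} {x₀ : Finset Ω} (hx₀ : x₀.card = k)
    (hk : Fintype.card Ω = 2 * k) : ∃ g : KSubset Ω k → KSubset Ω k, Function.Injective g ∧
      (∀ x y, ((g x).1 \ (g y).1).card = (x.1 \ y.1).card) ∧ (∀ x, lev x₀ (g x) = lev x₀ x) ∧
      (∀ x y, dIn x₀ (g x) (g y) = dOut x₀ x y) ∧ (∀ x y, dOut x₀ (g x) (g y) = dIn x₀ x y) := by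
  have hc : Fintype.card {a // a ∈ x₀} = Fintype.card {a // ¬ a ∈ x₀} := by
    rw [Fintype.card_subtype_compl, Fintype.card_coe, hx₀, hk]
    omega
  let e := Fintype.equivOfCardEq hc
  obtain ⟨σ, hσ⟩ : ∃ σ : Equiv.Perm Ω, ∀ a, σ a ∈ x₀ ↔ a ∉ x₀ := by
    refine ⟨(Equiv.sumCompl (· ∈ x₀)).symm.trans (((Equiv.sumComm _ _).trans
      (Equiv.sumCongr e.symm e)).trans (Equiv.sumCompl (· ∈ x₀))), fun a => ?_⟩
    by_cases ha : a ∈ x₀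
    · simp [ha, Equiv.sumCompl_symm_apply_of_pos, (e ⟨a, ha⟩).2]
    · simp [ha, Equiv.sumCompl_symm_apply_of_neg]
  have hcard : ∀ s t : Finset Ω, (∀ a, σ a ∈ t ↔ a ∈ s) → t.card = s.card := by
    intro s t h
    rw [← Finset.card_map (s := s) σ.toEmbedding]
    congr 1
    ext a
    obtain ⟨b, rfl⟩ := σ.surjective a
    rw [h]
    simp
  have hlev : ∀ x : KSubset Ω k, (x₀ \ x.1).card = lev x₀ x := fun x =>
    card_sdiff_comm' (⟨x₀, hx₀⟩ : KSubset Ω k) x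
  refine ⟨fun x => ⟨(x.1.map σ.toEmbedding)ᶜ, by
    rw [Finset.card_compl, Finset.card_map, x.2, hk]; omega⟩, ?_, ?_, ?_, ?_, ?_⟩
  · intro x y h
    exact Subtype.ext (Finset.map_injective _ (compl_injective (congrArg Subtype.val h)))
  · intro x y
    rw [card_sdiff_comm' x y]
    refine hcard _ _ fun a => ?_
    simp [and_comm]
  · intro x
    rw [← hlev]
    refine hcard _ _ fun a => ?_
    simp [hσ, and_comm]
  · intro x y
    refine hcard _ _ fun a => ?_
    simp [hσ]
    tauto
  · intro x y
    refine hcard _ _ fun a => ?_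
    simp [hσ]
    tauto

lemma apply_eq_of_symCls_eq {k : ℕ} {x₀ : Finset Ω} (hx₀ : x₀.card = k)
    (hk : Fintype.card Ω = 2 * k) {x y x' y' : KSubset Ω k}
    (h : symCls x₀ x y = symCls x₀ x' y') {M : Matrix (KSubset Ω k) (KSubset Ω k) ℂ}
    (hM : M ∈ terwMat x₀ k) : M x y = M x' y' := by
  obtain ⟨g, hg, hadj, hlev, hin, hout⟩ := exists_swap_automorphism hx₀ hk
  have h1 : cls x₀ x y = cls x₀ x' y' ∨ cls x₀ (g x) (g y) = cls x₀ x' y' := by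
    have hgc : cls x₀ (g x) (g y) =
        ((cls x₀ x y).1, (cls x₀ x y).2.1, (cls x₀ x y).2.2.2, (cls x₀ x y).2.2.1) := by
      simp only [cls, hlev, hin, hout]
      split_ifs <;> rfl
    rw [hgc]
    simp only [symCls, Prod.ext_iff] at h ⊢
    omega
  rcases h1 with h1 | h1
  · exact apply_eq_of_cls_eq hx₀ h1 hM
  · rw [← apply_eq_of_automorphism hx₀ g hg hadj hlev hM x y]
    exact apply_eq_of_cls_eq hx₀ h1 hM

/-! ### Supports of products of swap matrices -/

lemma mul_apply_ne_zero {V : Type} [Fintype V] (M N : Matrix V V ℕ) (x y : V) :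
    (M * N) x y ≠ 0 ↔ ∃ z, M x z ≠ 0 ∧ N z y ≠ 0 := by
  simp [Matrix.mul_apply, Finset.sum_eq_zero_iff]

section Support

variable {k : ℕ} {x₀ : Finset Ω}

lemma dOut_add_lev (x y : KSubset Ω k) :
    dOut x₀ x y + lev x₀ x = dOut x₀ y x + lev x₀ y := by
  have h1 := Finset.card_sdiff_add_card_inter (x.1 \ x₀) y.1
  have h2 := Finset.card_sdiff_add_card_inter (y.1 \ x₀) x.1
  have h3 : (x.1 \ x₀) ∩ y.1 = (y.1 \ x₀) ∩ x.1 := by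
    ext a
    simp only [Finset.mem_inter, Finset.mem_sdiff]
    tauto
  rw [h3] at h1
  unfold dOut lev
  omega

lemma card_inter_add_lev (x : KSubset Ω k) : (x.1 ∩ x₀).card + lev x₀ x = k := by
  have := Finset.card_sdiff_add_card_inter x.1 x₀
  have := x.2
  unfold lev
  omega

lemma dIn_add_lev (x y : KSubset Ω k) :
    dIn x₀ x y + lev x₀ x = dIn x₀ y x + lev x₀ y := by
  have h1 := Finset.card_sdiff_add_card_inter (x.1 ∩ x₀) y.1
  have h2 := Finset.card_sdiff_add_card_inter (y.1 ∩ x₀) x.1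
  have h3 : (x.1 ∩ x₀) ∩ y.1 = (y.1 ∩ x₀) ∩ x.1 := by
    ext a
    simp only [Finset.mem_inter]
    tauto
  rw [h3] at h1
  have := card_inter_add_lev (x₀ := x₀) x
  have := card_inter_add_lev (x₀ := x₀) y
  unfold dIn
  omega

lemma mem_iff_of_sdiff {x z : Finset Ω} {e f : Ω} (h : x \ z = {e} ∧ z \ x = {f}) :
    (e ∈ x ∧ f ∉ x) ∧ ∀ a, a ∈ z ↔ a = f ∨ a ≠ e ∧ a ∈ x := by
  obtain ⟨he, hf, rfl⟩ := sdiff_eq_singleton_iff.1 h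
  exact ⟨⟨he, hf⟩, fun a => by rw [Finset.mem_insert, Finset.mem_erase]⟩

lemma exists_ksubset_swap {x : KSubset Ω k} {e f : Ω} (he : e ∈ x.1) (hf : f ∉ x.1) :
    ∃ z : KSubset Ω k, x.1 \ z.1 = {e} ∧ z.1 \ x.1 = {f} := by
  refine ⟨⟨insert f (x.1.erase e), ?_⟩, sdiff_eq_singleton_iff.2 ⟨he, hf, rfl⟩⟩
  rw [Finset.card_insert_of_notMem (by simp [hf]), Finset.card_erase_add_one he, x.2]

lemma inner_support {x z : KSubset Ω k} (h : swapMat k x₀ x₀ x z ≠ 0) (y : KSubset Ω k) :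
    dIn x₀ x y ≤ dIn x₀ z y + 1 ∧ dOut x₀ x y = dOut x₀ z y ∧ lev x₀ x = lev x₀ z := by
  refine ⟨?_, ?_, swapMat_lev (Or.inl rfl) h⟩ <;>
    obtain ⟨e, he, f, hf, hef⟩ := swapMat_ne_zero.1 h <;>
    obtain ⟨-, hz⟩ := mem_iff_of_sdiff hef
  · refine (Finset.card_le_card ?_).trans (Finset.card_insert_le e _)
    intro a
    simp only [Finset.mem_insert, Finset.mem_sdiff, Finset.mem_inter, hz]
    tauto
  · unfold dOut
    congr 1
    ext a
    simp only [Finset.mem_sdiff, hz]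
    grind

lemma outer_support {x z : KSubset Ω k} (h : swapMat k x₀ᶜ x₀ᶜ x z ≠ 0) (y : KSubset Ω k) :
    dIn x₀ x y = dIn x₀ z y ∧ dOut x₀ x y ≤ dOut x₀ z y + 1 ∧ lev x₀ x = lev x₀ z := by
  refine ⟨?_, ?_, swapMat_lev (Or.inr rfl) h⟩ <;>
    obtain ⟨e, he, f, hf, hef⟩ := swapMat_ne_zero.1 h <;>
    obtain ⟨-, hz⟩ := mem_iff_of_sdiff hef <;>
    rw [Finset.mem_compl] at he hf
  · unfold dIn
    congr 1
    ext a
    simp only [Finset.mem_sdiff, Finset.mem_inter, hz]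
    grind
  · refine (Finset.card_le_card ?_).trans (Finset.card_insert_le f _)
    intro a
    simp only [Finset.mem_insert, Finset.mem_sdiff, hz]
    tauto

lemma raise_support {x z : KSubset Ω k} (h : swapMat k x₀ᶜ x₀ x z ≠ 0) (y : KSubset Ω k) :
    dIn x₀ x y ≤ dIn x₀ z y ∧ dOut x₀ x y ≤ dOut x₀ z y ∧ lev x₀ x = lev x₀ z + 1 := by
  obtain ⟨e, he, f, hf, hef⟩ := swapMat_ne_zero.1 h
  obtain ⟨-, hz⟩ := mem_iff_of_sdiff hef
  rw [Finset.mem_compl] at he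
  refine ⟨Finset.card_le_card fun a => ?_, Finset.card_le_card fun a => ?_, ?_⟩
  · simp only [Finset.mem_sdiff, Finset.mem_inter, hz]
    grind
  · simp only [Finset.mem_sdiff, hz]
    grind
  · have := lev_add x₀ hef
    simpa [he, hf] using this

lemma exists_inner_step {x y : KSubset Ω k} (hl : lev x₀ y ≤ lev x₀ x) {r : ℕ}
    (hr : dIn x₀ x y = r + 1) : ∃ z, swapMat k x₀ x₀ x z ≠ 0 ∧ dIn x₀ z y = r := by
  have h1 := dIn_add_lev (x₀ := x₀) x y
  obtain ⟨e, he⟩ := Finset.card_pos.1 (show 0 < dIn x₀ x y by omega)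
  obtain ⟨f, hf⟩ := Finset.card_pos.1 (show 0 < dIn x₀ y x by omega)
  simp only [Finset.mem_sdiff, Finset.mem_inter] at he hf
  obtain ⟨z, hzx⟩ := exists_ksubset_swap he.1.1 hf.2
  obtain ⟨-, hz⟩ := mem_iff_of_sdiff hzx
  refine ⟨z, swapMat_ne_zero.2 ⟨e, he.1.2, f, hf.1.2, hzx⟩, ?_⟩
  have h2 : (x.1 ∩ x₀) \ y.1 = insert e ((z.1 ∩ x₀) \ y.1) := by
    ext a
    simp only [Finset.mem_insert, Finset.mem_sdiff, Finset.mem_inter, hz]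
    grind
  rw [dIn, h2, Finset.card_insert_of_notMem] at hr
  · exact Nat.succ_injective hr
  · simp only [Finset.mem_sdiff, Finset.mem_inter, hz]
    grind

lemma exists_outer_step {x y : KSubset Ω k} (hl : lev x₀ y ≤ lev x₀ x) {r : ℕ}
    (hr : dOut x₀ x y = r + 1) : ∃ z, swapMat k x₀ᶜ x₀ᶜ x z ≠ 0 ∧ dOut x₀ z y = r := by
  have h1 := dOut_add_lev (x₀ := x₀) x y
  obtain ⟨f, hf⟩ := Finset.card_pos.1 (show 0 < dOut x₀ x y by omega)
  obtain ⟨e, he⟩ := Finset.card_pos.1 (show 0 < dOut x₀ y x by omega)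
  simp only [Finset.mem_sdiff] at he hf
  obtain ⟨z, hzx⟩ := exists_ksubset_swap he.1.1 hf.2
  obtain ⟨-, hz⟩ := mem_iff_of_sdiff hzx
  refine ⟨z, swapMat_ne_zero.2 ⟨e, by simpa using he.1.2, f, by simpa using hf.1.2, hzx⟩, ?_⟩
  have h2 : (y.1 \ x₀) \ x.1 = insert f ((y.1 \ x₀) \ z.1) := by
    ext a
    simp only [Finset.mem_insert, Finset.mem_sdiff, hz]
    grind
  rw [dOut, h2, Finset.card_insert_of_notMem] at hr
  · exact Nat.succ_injective hr
  · simp only [Finset.mem_sdiff, hz]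
    grind

lemma exists_raise_step {x y : KSubset Ω k} (hl : lev x₀ y < lev x₀ x)
    (hi : dIn x₀ x y = 0) (ho : dOut x₀ x y = 0) :
    ∃ z, swapMat k x₀ᶜ x₀ x z ≠ 0 ∧ dIn x₀ z y = 0 ∧ dOut x₀ z y = 0 := by
  have h1 := dOut_add_lev (x₀ := x₀) x y
  have h2 := dIn_add_lev (x₀ := x₀) x y
  obtain ⟨e, he⟩ := Finset.card_pos.1 (show 0 < dOut x₀ y x by omega)
  obtain ⟨f, hf⟩ := Finset.card_pos.1 (show 0 < dIn x₀ y x by omega)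
  simp only [Finset.mem_sdiff, Finset.mem_inter] at he hf
  obtain ⟨z, hzx⟩ := exists_ksubset_swap he.1.1 hf.2
  obtain ⟨-, hz⟩ := mem_iff_of_sdiff hzx
  rw [dIn, Finset.card_eq_zero, Finset.sdiff_eq_empty_iff_subset] at hi
  rw [dOut, Finset.card_eq_zero, Finset.sdiff_eq_empty_iff_subset] at ho
  refine ⟨z, swapMat_ne_zero.2 ⟨e, by simpa using he.1.2, f, hf.1.2, hzx⟩, ?_, ?_⟩ <;>
    simp only [dIn, dOut, Finset.card_eq_zero, Finset.sdiff_eq_empty_iff_subset] <;> intro a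
  · have := @hi a
    simp only [Finset.mem_inter, hz] at this ⊢
    grind
  · have := @ho a
    simp only [Finset.mem_sdiff, hz] at this ⊢
    grind

lemma raise_pow_ne_zero (m : ℕ) (x y : KSubset Ω k) :
    (swapMat k x₀ᶜ x₀ ^ m) x y ≠ 0 ↔
      lev x₀ x = lev x₀ y + m ∧ dIn x₀ x y = 0 ∧ dOut x₀ x y = 0 := by
  induction m generalizing x with
  | zero =>
    rw [pow_zero, Matrix.one_apply]
    constructor
    · intro h
      obtain rfl : x = y := by simpa using h
      simp [dIn, dOut, Finset.sdiff_eq_empty_iff_subset]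
    · rintro ⟨hl, hi, ho⟩
      have h1 := dOut_add_lev (x₀ := x₀) x y
      have ho' : dOut x₀ y x = 0 := by omega
      rw [dIn, Finset.card_eq_zero, Finset.sdiff_eq_empty_iff_subset] at hi
      rw [dOut, Finset.card_eq_zero, Finset.sdiff_eq_empty_iff_subset] at ho'
      have hsub : x.1 ⊆ y.1 := by
        intro a ha
        by_cases h : a ∈ x₀
        · exact hi (Finset.mem_inter.2 ⟨ha, h⟩)
        · exact ho' (Finset.mem_sdiff.2 ⟨ha, h⟩)
      simp [Subtype.ext (Finset.eq_of_subset_of_card_le hsub (by rw [x.2, y.2]))]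
  | succ m ih =>
    simp only [pow_succ', mul_apply_ne_zero, ih]
    constructor
    · rintro ⟨z, hz, hl, hi, ho⟩
      have := raise_support hz y
      omega
    · rintro ⟨hl, hi, ho⟩
      obtain ⟨z, hz, hi', ho'⟩ := exists_raise_step (by omega) hi ho
      have := raise_support hz y
      exact ⟨z, hz, by omega, hi', ho'⟩

/-- The support of `M` is contained in a region of pairs `(x,y)` given by a level difference
and a condition on the remaining invariants, and contains another such region. -/
structure SupportedOn (x₀ : Finset Ω) (M : Matrix (KSubset Ω k) (KSubset Ω k) ℕ) (m : ℕ)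
    (P Q : ℕ → ℕ → Prop) : Prop where
  of_ne_zero : ∀ x y, M x y ≠ 0 → lev x₀ x = lev x₀ y + m ∧ P (dIn x₀ x y) (dOut x₀ x y)
  ne_zero : ∀ x y, lev x₀ x = lev x₀ y + m → Q (dIn x₀ x y) (dOut x₀ x y) → M x y ≠ 0

lemma SupportedOn.inner_mul {M : Matrix (KSubset Ω k) (KSubset Ω k) ℕ} {m : ℕ}
    {P Q : ℕ → ℕ → Prop} (h : SupportedOn x₀ M m P Q) :
    SupportedOn x₀ (swapMat k x₀ x₀ * M) m (fun a b => ∃ a', a ≤ a' + 1 ∧ P a' b)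
      (fun a b => ∃ a', a = a' + 1 ∧ Q a' b) := by
  constructor
  · intro x y hxy
    obtain ⟨z, hz, hM⟩ := (mul_apply_ne_zero _ _ _ _).1 hxy
    have h1 := inner_support hz y
    have h2 := h.of_ne_zero z y hM
    exact ⟨by omega, _, h1.1, h1.2.1 ▸ h2.2⟩
  · rintro x y hl ⟨r, hr, hQ⟩
    obtain ⟨z, hz, hzr⟩ := exists_inner_step (by omega) hr
    have h1 := inner_support hz y
    refine (mul_apply_ne_zero _ _ _ _).2 ⟨z, hz, h.ne_zero z y (by omega) ?_⟩
    rwa [hzr, ← h1.2.1]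

lemma SupportedOn.outer_mul {M : Matrix (KSubset Ω k) (KSubset Ω k) ℕ} {m : ℕ}
    {P Q : ℕ → ℕ → Prop} (h : SupportedOn x₀ M m P Q) :
    SupportedOn x₀ (swapMat k x₀ᶜ x₀ᶜ * M) m (fun a b => ∃ b', b ≤ b' + 1 ∧ P a b')
      (fun a b => ∃ b', b = b' + 1 ∧ Q a b') := by
  constructor
  · intro x y hxy
    obtain ⟨z, hz, hM⟩ := (mul_apply_ne_zero _ _ _ _).1 hxy
    have h1 := outer_support hz y
    have h2 := h.of_ne_zero z y hM
    exact ⟨by omega, _, h1.2.1, h1.1 ▸ h2.2⟩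
  · rintro x y hl ⟨r, hr, hQ⟩
    obtain ⟨z, hz, hzr⟩ := exists_outer_step (by omega) hr
    have h1 := outer_support hz y
    refine (mul_apply_ne_zero _ _ _ _).2 ⟨z, hz, h.ne_zero z y (by omega) ?_⟩
    rwa [hzr, ← h1.1]

lemma SupportedOn.add {M N : Matrix (KSubset Ω k) (KSubset Ω k) ℕ} {m : ℕ}
    {P Q P' Q' : ℕ → ℕ → Prop} (h : SupportedOn x₀ M m P Q) (h' : SupportedOn x₀ N m P' Q') :
    SupportedOn x₀ (M + N) m (fun a b => P a b ∨ P' a b) (fun a b => Q a b ∨ Q' a b) := by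
  constructor
  · intro x y hxy
    have : M x y ≠ 0 ∨ N x y ≠ 0 := by
      rw [Matrix.add_apply] at hxy
      omega
    rcases this with h0 | h0
    · exact (h.of_ne_zero x y h0).imp_right Or.inl
    · exact (h'.of_ne_zero x y h0).imp_right Or.inr
  · rintro x y hl (hQ | hQ) <;> rw [Matrix.add_apply]
    · have := h.ne_zero x y hl hQ
      omega
    · have := h'.ne_zero x y hl hQ
      omega

lemma SupportedOn.mono {M : Matrix (KSubset Ω k) (KSubset Ω k) ℕ} {m : ℕ}
    {P Q P' Q' : ℕ → ℕ → Prop} (h : SupportedOn x₀ M m P Q) (hP : ∀ a b, P a b → P' a b)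
    (hQ : ∀ a b, Q' a b → Q a b) : SupportedOn x₀ M m P' Q' :=
  ⟨fun x y hxy => (h.of_ne_zero x y hxy).imp_right (hP _ _),
    fun x y hl hxy => h.ne_zero x y hl (hQ _ _ hxy)⟩

lemma supportedOn_raise_pow (m : ℕ) : SupportedOn x₀ (swapMat k x₀ᶜ x₀ ^ m) m
    (fun a b => a = 0 ∧ b = 0) (fun a b => a = 0 ∧ b = 0) :=
  ⟨fun x y h => (raise_pow_ne_zero m x y).1 h,
    fun x y hl h => (raise_pow_ne_zero m x y).2 ⟨hl, h⟩⟩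

lemma supportedOn_outer_pow (q m : ℕ) :
    SupportedOn x₀ (swapMat k x₀ᶜ x₀ᶜ ^ q * swapMat k x₀ᶜ x₀ ^ m) m
      (fun a b => a = 0 ∧ b ≤ q) (fun a b => a = 0 ∧ b = q) := by
  induction q with
  | zero =>
    rw [pow_zero, one_mul]
    exact (supportedOn_raise_pow m).mono (by omega) (by omega)
  | succ q ih =>
    rw [pow_succ', mul_assoc]
    refine ih.outer_mul.mono ?_ ?_
    · rintro a b ⟨b', h⟩
      omega
    · rintro a b ⟨ha, hb⟩
      exact ⟨q, by omega⟩

lemma supportedOn_inner_pow (r q m : ℕ) :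
    SupportedOn x₀ (swapMat k x₀ x₀ ^ r * (swapMat k x₀ᶜ x₀ᶜ ^ q * swapMat k x₀ᶜ x₀ ^ m)) m
      (fun a b => a ≤ r ∧ b ≤ q) (fun a b => a = r ∧ b = q) := by
  induction r with
  | zero =>
    rw [pow_zero, one_mul]
    exact (supportedOn_outer_pow q m).mono (by omega) (by omega)
  | succ q ih =>
    rw [pow_succ', mul_assoc]
    refine ih.inner_mul.mono ?_ ?_
    · rintro a b ⟨b', h⟩
      omega
    · rintro a b ⟨ha, hb⟩
      exact ⟨q, by omega⟩

lemma supportedOn_inner_mul_outer_pow (q m : ℕ) :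
    SupportedOn x₀ ((swapMat k x₀ x₀ * swapMat k x₀ᶜ x₀ᶜ) ^ q * swapMat k x₀ᶜ x₀ ^ m) m
      (fun a b => a ≤ q ∧ b ≤ q) (fun a b => a = q ∧ b = q) := by
  induction q with
  | zero =>
    rw [pow_zero, one_mul]
    exact (supportedOn_raise_pow m).mono (by omega) (by omega)
  | succ q ih =>
    rw [pow_succ', mul_assoc, mul_assoc]
    refine ih.outer_mul.inner_mul.mono ?_ ?_
    · rintro a b ⟨a', h1, b', h2⟩
      omega
    · rintro a b ⟨ha, hb⟩
      exact ⟨q, by omega, q, by omega⟩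

lemma supportedOn_flat_pow (r q m : ℕ) :
    SupportedOn x₀ ((swapMat k x₀ x₀ + swapMat k x₀ᶜ x₀ᶜ) ^ r *
      ((swapMat k x₀ x₀ * swapMat k x₀ᶜ x₀ᶜ) ^ q * swapMat k x₀ᶜ x₀ ^ m)) m
      (fun a b => a ≤ q + r ∧ b ≤ q + r ∧ a + b ≤ 2 * q + r)
      (fun a b => min a b = q ∧ max a b = q + r) := by
  induction r with
  | zero =>
    rw [pow_zero, one_mul]
    exact (supportedOn_inner_mul_outer_pow q m).mono (by omega) (by omega)
  | succ r ih =>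
    rw [pow_succ', mul_assoc, add_mul]
    refine (ih.inner_mul.add ih.outer_mul).mono ?_ ?_
    · rintro a b (⟨a', h⟩ | ⟨b', h⟩) <;> omega
    · rintro a b ⟨h1, h2⟩
      rcases le_total a b with h | h
      · exact Or.inr ⟨q + r, by omega⟩
      · exact Or.inl ⟨q + r, by omega⟩

end Support

lemma exists_mem_of_supportedOn {k : ℕ} {x₀ : Finset Ω}
    (hlev : ∀ φ, levDiag x₀ φ ∈ terwMat x₀ k) {M : Matrix (KSubset Ω k) (KSubset Ω k) ℕ}
    (hM : toC M ∈ terwMat x₀ k) {x y : KSubset Ω k} (hl : lev x₀ y ≤ lev x₀ x)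
    {P Q : ℕ → ℕ → Prop} (h : SupportedOn x₀ M (lev x₀ x - lev x₀ y) P Q)
    (hQ : Q (dIn x₀ x y) (dOut x₀ x y)) :
    ∃ N ∈ terwMat x₀ k, N x y ≠ 0 ∧ ∀ x' y', N x' y' ≠ 0 →
      lev x₀ x' = lev x₀ x ∧ lev x₀ y' = lev x₀ y ∧ P (dIn x₀ x' y') (dOut x₀ x' y') := by
  refine ⟨toC M * levDiag x₀ fun i => if i = lev x₀ y then 1 else 0, mul_mem hM (hlev _), ?_, ?_⟩
  · rw [levDiag, Matrix.mul_diagonal, if_pos rfl, mul_one, toC_apply_ne_zero]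
    exact h.ne_zero x y (by omega) hQ
  · intro x' y' h0
    rw [levDiag, Matrix.mul_diagonal] at h0
    have h1 : lev x₀ y' = lev x₀ y := by
      by_contra hne
      simp [hne] at h0
    have h2 := h.of_ne_zero x' y' ((toC_apply_ne_zero _ _ _).1 (left_ne_zero_of_mul h0))
    exact ⟨by omega, h1, h2.2⟩

lemma finrank_terwMat {k : ℕ} {x₀ : Finset Ω} (hx₀ : x₀.card = k) (hD : 2 ≤ Fintype.card Ω)
    (hk1 : 1 ≤ k) (hk2 : k < Fintype.card Ω) (hk : Fintype.card Ω ≠ 2 * k) :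
    Module.finrank ℂ (Subalgebra.toSubmodule (terwMat x₀ k)) =
      (Finset.univ.image fun p : KSubset Ω k × KSubset Ω k => cls x₀ p.1 p.2).card := by
  have hlev := levDiag_mem hx₀ hD hk1 hk2
  have hA : adjMat Ω k ∈ terwMat x₀ k := Algebra.subset_adjoin (Set.mem_insert _ _)
  have key : ∀ x y, lev x₀ y ≤ lev x₀ x → ∃ N ∈ terwMat x₀ k, N x y ≠ 0 ∧ ∀ x' y', N x' y' ≠ 0 →
      lev x₀ x' = lev x₀ x ∧ lev x₀ y' = lev x₀ y ∧
        (dIn x₀ x' y' ≤ dIn x₀ x y ∧ dOut x₀ x' y' ≤ dOut x₀ x y) := by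
    intro x y hl
    refine exists_mem_of_supportedOn hlev ?_ hl
      (supportedOn_inner_pow (dIn x₀ x y) (dOut x₀ x y) (lev x₀ x - lev x₀ y)) ⟨rfl, rfl⟩
    rw [map_mul, map_mul, map_pow, map_pow, map_pow]
    exact mul_mem (pow_mem (inner_mem hx₀ hk hlev hA) _)
      (mul_mem (pow_mem (outer_mem hx₀ hk hlev hA) _) (pow_mem (raise_mem hlev hA) _))
  refine finrank_eq_card_classes _ (cls x₀) (fun M hM x y x' y' h => apply_eq_of_cls_eq hx₀ h hM)
    (fun c => c.2.2.1 + c.2.2.2) fun x y => ?_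
  rcases le_or_gt (lev x₀ y) (lev x₀ x) with hl | hl
  · obtain ⟨N, hN, h0, h1⟩ := key x y hl
    refine ⟨N, hN, h0, fun x' y' h => ?_⟩
    obtain ⟨hx, hy, hi, ho⟩ := h1 x' y' h
    simp only [cls, hx, hy, hl, if_true, Prod.mk.injEq, true_and]
    omega
  · obtain ⟨N, hN, h0, h1⟩ := key y x hl.le
    refine ⟨N.transpose, transpose_mem hN, h0, fun x' y' h => ?_⟩
    obtain ⟨hx, hy, hi, ho⟩ := h1 y' x' h
    simp only [cls, hx, hy, hl.not_ge, if_false, Prod.mk.injEq, true_and]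
    omega

lemma finrank_terwMat_half {k : ℕ} {x₀ : Finset Ω} (hx₀ : x₀.card = k) (hD : 2 ≤ Fintype.card Ω)
    (hk1 : 1 ≤ k) (hk2 : k < Fintype.card Ω) (hk : Fintype.card Ω = 2 * k) :
    Module.finrank ℂ (Subalgebra.toSubmodule (terwMat x₀ k)) =
      (Finset.univ.image fun p : KSubset Ω k × KSubset Ω k => symCls x₀ p.1 p.2).card := by
  have hlev := levDiag_mem hx₀ hD hk1 hk2
  have hA : adjMat Ω k ∈ terwMat x₀ k := Algebra.subset_adjoin (Set.mem_insert _ _)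
  have key : ∀ x y, lev x₀ y ≤ lev x₀ x → ∃ N ∈ terwMat x₀ k, N x y ≠ 0 ∧ ∀ x' y', N x' y' ≠ 0 →
      lev x₀ x' = lev x₀ x ∧ lev x₀ y' = lev x₀ y ∧
        (max (dIn x₀ x' y') (dOut x₀ x' y') ≤ max (dIn x₀ x y) (dOut x₀ x y) ∧
        dIn x₀ x' y' + dOut x₀ x' y' ≤ dIn x₀ x y + dOut x₀ x y) := by
    intro x y hl
    set q := min (dIn x₀ x y) (dOut x₀ x y) with hq
    set r := max (dIn x₀ x y) (dOut x₀ x y) - q with hr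
    refine exists_mem_of_supportedOn hlev ?_ hl
      ((supportedOn_flat_pow r q (lev x₀ x - lev x₀ y)).mono
        (P' := fun a b => max a b ≤ max (dIn x₀ x y) (dOut x₀ x y) ∧
          a + b ≤ dIn x₀ x y + dOut x₀ x y) (fun a b h => ?_) fun a b h => h)
      ⟨hq.symm, by omega⟩
    · rw [map_mul, map_mul, map_pow, map_pow, map_pow, map_mul, map_add]
      exact mul_mem (pow_mem (flat_mem hlev hA) _)
        (mul_mem (pow_mem (inner_mul_outer_mem hx₀ hlev hA) _) (pow_mem (raise_mem hlev hA) _))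
    · omega
  refine finrank_eq_card_classes _ (symCls x₀)
    (fun M hM x y x' y' h => apply_eq_of_symCls_eq hx₀ hk h hM)
    (fun c => toLex (c.2.2.1 + c.2.2.2, c.2.2.2)) fun x y => ?_
  rcases le_or_gt (lev x₀ y) (lev x₀ x) with hl | hl
  · obtain ⟨N, hN, h0, h1⟩ := key x y hl
    refine ⟨N, hN, h0, fun x' y' h => ?_⟩
    obtain ⟨hx, hy, hi, ho⟩ := h1 x' y' h
    simp only [symCls, cls, hx, hy, hl, if_true, Prod.mk.injEq, true_and, Prod.Lex.toLex_lt_toLex]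
    omega
  · obtain ⟨N, hN, h0, h1⟩ := key y x hl.le
    refine ⟨N.transpose, transpose_mem hN, h0, fun x' y' h => ?_⟩
    obtain ⟨hx, hy, hi, ho⟩ := h1 y' x' h
    simp only [symCls, cls, hx, hy, hl.not_ge, if_false, Prod.mk.injEq, true_and,
      Prod.Lex.toLex_lt_toLex]
    omega


/-! ### Counting the invariants -/

/-- For subsets of sizes `j` and `i` of a set of size `c`, the largest possible value of the
smaller of the cardinalities of their two differences. -/
def maxDiff (c j i : ℕ) : ℕ := min (min i j) (min (c - i) (c - j))

lemma maxDiff_comm (c j i : ℕ) : maxDiff c j i = maxDiff c i j := by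
  unfold maxDiff
  omega

lemma exists_subsets {S : Finset Ω} {j i a : ℕ} (hj : j ≤ S.card) (hij : i ≤ j)
    (ha : a ≤ maxDiff S.card j i) :
    ∃ P Q : Finset Ω, P ⊆ S ∧ Q ⊆ S ∧ P.card = j ∧ Q.card = i ∧ (Q \ P).card = a := by
  unfold maxDiff at ha
  obtain ⟨P, hPS, hP⟩ := Finset.exists_subset_card_eq hj
  obtain ⟨U, hUP, hU⟩ := Finset.exists_subset_card_eq (show i - a ≤ P.card by omega)
  obtain ⟨W, hWP, hW⟩ := Finset.exists_subset_card_eq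
    (show a ≤ (S \ P).card by rw [Finset.card_sdiff_of_subset hPS]; omega)
  have hd : Disjoint U W :=
    (Finset.disjoint_sdiff (s := P) (t := S)).mono hUP hWP
  refine ⟨P, U ∪ W, hPS, Finset.union_subset (hUP.trans hPS)
    (hWP.trans Finset.sdiff_subset), hP, ?_, ?_⟩
  · rw [Finset.card_union_of_disjoint hd]
    omega
  · rw [Finset.union_sdiff_distrib, Finset.sdiff_eq_empty_iff_subset.2 hUP, Finset.empty_union,
      Finset.sdiff_eq_self_of_disjoint, hW]
    exact (Finset.disjoint_sdiff (s := P) (t := S)).symm.mono_left hWP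

/-- Replacing a subset `P` of `x₀` by a set `Q` of the same size outside of `x₀` gives a vertex. -/
lemma exists_vertex {k : ℕ} {x₀ P Q : Finset Ω} (hx₀ : x₀.card = k) (hP : P ⊆ x₀)
    (hQ : Q ⊆ x₀ᶜ) (h : P.card = Q.card) :
    ∃ x : KSubset Ω k, x.1 ∩ x₀ = x₀ \ P ∧ x.1 \ x₀ = Q := by
  have hd : Disjoint (x₀ \ P) Q :=
    (disjoint_compl_right (a := x₀)).mono Finset.sdiff_subset hQ
  refine ⟨⟨x₀ \ P ∪ Q, ?_⟩, ?_, ?_⟩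
  · have := Finset.card_le_card hP
    rw [Finset.card_union_of_disjoint hd, Finset.card_sdiff_of_subset hP]
    omega
  · ext a
    have := @hQ a
    simp only [Finset.mem_inter, Finset.mem_union, Finset.mem_sdiff, Finset.mem_compl] at *
    tauto
  · ext a
    have := @hQ a
    simp only [Finset.mem_union, Finset.mem_sdiff, Finset.mem_compl] at *
    tauto

section Count

variable {k : ℕ} {x₀ : Finset Ω}

lemma exists_vertices (hx₀ : x₀.card = k) {j i a b : ℕ} (hij : i ≤ j) (hjk : j ≤ k)
    (hjn : j ≤ Fintype.card Ω - k) (ha : a ≤ maxDiff k j i)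
    (hb : b ≤ maxDiff (Fintype.card Ω - k) j i) :
    ∃ x y : KSubset Ω k, lev x₀ x = j ∧ lev x₀ y = i ∧ dIn x₀ x y = a ∧ dOut x₀ x y = b := by
  have hc : x₀ᶜ.card = Fintype.card Ω - k := by rw [Finset.card_compl, hx₀]
  obtain ⟨P, Q, hP, hQ, hPj, hQi, hPQ⟩ :=
    exists_subsets (S := x₀) (hjk.trans hx₀.ge) hij (hx₀.symm ▸ ha)
  obtain ⟨P', Q', hP', hQ', hPj', hQi', hPQ'⟩ :=
    exists_subsets (S := x₀ᶜ) (hjn.trans hc.ge) hij (hc.symm ▸ hb)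
  obtain ⟨x, hx, hx'⟩ := exists_vertex hx₀ hP hP' (hPj.trans hPj'.symm)
  obtain ⟨y, hy, hy'⟩ := exists_vertex hx₀ hQ hQ' (hQi.trans hQi'.symm)
  refine ⟨x, y, by rw [lev, hx', hPj'], by rw [lev, hy', hQi'], ?_, ?_⟩
  · have : (x.1 ∩ x₀) \ y.1 = (x.1 ∩ x₀) \ (y.1 ∩ x₀) := by
      ext a
      simp only [Finset.mem_inter, Finset.mem_sdiff]
      tauto
    rw [dIn, this, hx, hy, ← hPQ]
    congr 1
    ext a
    have := @hQ a
    simp only [Finset.mem_sdiff]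
    tauto
  · have : (y.1 \ x₀) \ x.1 = (y.1 \ x₀) \ (x.1 \ x₀) := by
      ext a
      simp only [Finset.mem_sdiff]
      tauto
    rw [dOut, this, hx', hy', hPQ']

lemma lev_le_compl (hx₀ : x₀.card = k) (x : KSubset Ω k) : lev x₀ x ≤ Fintype.card Ω - k := by
  have h : lev x₀ x ≤ x₀ᶜ.card := Finset.card_le_card fun a ha =>
    Finset.mem_compl.2 (Finset.mem_sdiff.1 ha).2
  rwa [Finset.card_compl, hx₀] at h

lemma dIn_le_maxDiff (hx₀ : x₀.card = k) {x y : KSubset Ω k} (h : lev x₀ y ≤ lev x₀ x) :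
    dIn x₀ x y ≤ maxDiff k (lev x₀ x) (lev x₀ y) := by
  have h1 : dIn x₀ x y ≤ (x.1 ∩ x₀).card := Finset.card_le_card Finset.sdiff_subset
  have h2 : dIn x₀ x y ≤ (x₀ \ y.1).card :=
    Finset.card_le_card (Finset.sdiff_subset_sdiff Finset.inter_subset_right le_rfl)
  have h3 := card_inter_add_lev (x₀ := x₀) x
  have h4 := card_inter_add_lev (x₀ := x₀) y
  have h5 := Finset.card_sdiff_add_card_inter x₀ y.1
  rw [Finset.inter_comm] at h5
  unfold maxDiff
  omega

lemma dOut_le_maxDiff (hx₀ : x₀.card = k) {x y : KSubset Ω k} (h : lev x₀ y ≤ lev x₀ x) :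
    dOut x₀ x y ≤ maxDiff (Fintype.card Ω - k) (lev x₀ x) (lev x₀ y) := by
  have h1 : dOut x₀ x y ≤ lev x₀ y := Finset.card_le_card Finset.sdiff_subset
  have h2 : dOut x₀ x y ≤ (x₀ᶜ \ (x.1 \ x₀)).card := by
    refine Finset.card_le_card fun a => ?_
    simp only [Finset.mem_sdiff, Finset.mem_compl]
    tauto
  have h3 : (x₀ᶜ \ (x.1 \ x₀)).card = Fintype.card Ω - k - lev x₀ x := by
    rw [Finset.card_sdiff_of_subset, Finset.card_compl, hx₀, lev]
    intro a
    simp only [Finset.mem_sdiff, Finset.mem_compl]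
    tauto
  unfold maxDiff
  omega

lemma mem_image_cls (hx₀ : x₀.card = k) (j i a b : ℕ) :
    (j, i, a, b) ∈ (Finset.univ.image fun p : KSubset Ω k × KSubset Ω k => cls x₀ p.1 p.2) ↔
      j < min k (Fintype.card Ω - k) + 1 ∧ i < min k (Fintype.card Ω - k) + 1 ∧
        b < maxDiff (Fintype.card Ω - k) j i + 1 ∧ a < maxDiff k j i + 1 := by
  simp only [Finset.mem_image, Finset.mem_univ, true_and, Prod.exists, Nat.lt_succ_iff, le_min_iff]
  constructor
  · rintro ⟨x, y, h⟩
    have h1 := lev_le x₀ x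
    have h2 := lev_le x₀ y
    have h3 := lev_le_compl hx₀ x
    have h4 := lev_le_compl hx₀ y
    unfold cls at h
    split_ifs at h with hl <;> obtain ⟨rfl, rfl, rfl, rfl⟩ := h
    · exact ⟨⟨h1, h3⟩, ⟨h2, h4⟩, dOut_le_maxDiff hx₀ hl, dIn_le_maxDiff hx₀ hl⟩
    · refine ⟨⟨h1, h3⟩, ⟨h2, h4⟩, ?_, ?_⟩ <;> rw [maxDiff_comm]
      · exact dOut_le_maxDiff hx₀ (not_le.1 hl).le
      · exact dIn_le_maxDiff hx₀ (not_le.1 hl).le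
  · rintro ⟨⟨hjk, hjn⟩, ⟨hik, hin⟩, hb, ha⟩
    rcases le_or_gt i j with hij | hij
    · obtain ⟨x, y, rfl, rfl, rfl, rfl⟩ := exists_vertices hx₀ hij hjk hjn ha hb
      exact ⟨x, y, if_pos hij⟩
    · rw [maxDiff_comm] at ha hb
      obtain ⟨x, y, rfl, rfl, rfl, rfl⟩ := exists_vertices hx₀ hij.le hik hin ha hb
      exact ⟨y, x, if_neg hij.not_ge⟩

lemma mem_image_symCls (hx₀ : x₀.card = k) (hk : Fintype.card Ω = 2 * k) (j i a b : ℕ) :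
    (j, i, a, b) ∈ (Finset.univ.image fun p : KSubset Ω k × KSubset Ω k => symCls x₀ p.1 p.2) ↔
      j < k + 1 ∧ i < k + 1 ∧ b < maxDiff k j i + 1 ∧ a < b + 1 := by
  have hkk : Fintype.card Ω - k = k := by omega
  have key := mem_image_cls (x₀ := x₀) hx₀
  simp only [hkk, min_self, Finset.mem_image, Finset.mem_univ, true_and, Prod.exists,
    Prod.mk.injEq, symCls] at key ⊢
  constructor
  · rintro ⟨x, y, rfl, rfl, rfl, rfl⟩
    generalize hc : cls x₀ x y = c
    obtain ⟨h1, h2, h3, h4⟩ := (key c.1 c.2.1 c.2.2.1 c.2.2.2).1 ⟨x, y, hc⟩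
    exact ⟨h1, h2, max_lt h4 h3, Nat.lt_succ_of_le min_le_max⟩
  · rintro ⟨hj, hi, hb, ha⟩
    obtain ⟨x, y, h⟩ := (key j i a b).2 ⟨hj, hi, hb, by omega⟩
    refine ⟨x, y, ?_⟩
    rw [h]
    exact ⟨rfl, rfl, by simp only; omega, by simp only; omega⟩

end Count

lemma card_eq_triple_sum {S : Finset (ℕ × ℕ × ℕ × ℕ)} (N : ℕ) (g : ℕ → ℕ → ℕ)
    (h : ℕ → ℕ → ℕ → ℕ)
    (hS : ∀ j i a b, (j, i, a, b) ∈ S ↔ j < N ∧ i < N ∧ b < g j i ∧ a < h j i b) :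
    S.card = ∑ j ∈ Finset.range N, ∑ i ∈ Finset.range N, ∑ b ∈ Finset.range (g j i), h j i b := by
  have : S.card = ((Finset.range N).sigma fun j => (Finset.range N).sigma fun i =>
      (Finset.range (g j i)).sigma fun b => Finset.range (h j i b)).card := by
    refine Finset.card_nbij' (fun t => ⟨t.1, t.2.1, t.2.2.2, t.2.2.1⟩)
      (fun t => (t.1, t.2.1, t.2.2.2, t.2.2.1)) ?_ ?_ ?_ ?_
    · rintro ⟨j, i, a, b⟩ ht
      simpa using (hS _ _ _ _).1 ht
    · rintro ⟨j, i, b, a⟩ ht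
      simpa [hS] using ht
    · exact fun _ _ => rfl
    · exact fun _ _ => rfl
  simp [this]

/-- The number of values of `cls` for `k`-element subsets of a set with `k + n` elements. -/
def clsCount (k n : ℕ) : ℕ :=
  ∑ j ∈ Finset.range (min k n + 1), ∑ i ∈ Finset.range (min k n + 1),
    (maxDiff n j i + 1) * (maxDiff k j i + 1)

lemma clsCount_comm (k n : ℕ) : clsCount k n = clsCount n k := by
  simp only [clsCount, min_comm k n, mul_comm]

lemma finrank_terwilliger_eq_clsCount {k : ℕ} {x₀ : Finset Ω} (hx₀ : x₀.card = k)
    (hD : 2 ≤ Fintype.card Ω) (hk1 : 1 ≤ k) (hk2 : k < Fintype.card Ω)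
    (hk : Fintype.card Ω ≠ 2 * k) :
    Module.finrank ℂ (terwilliger x₀ k) = clsCount k (Fintype.card Ω - k) := by
  rw [finrank_terwilliger, finrank_terwMat hx₀ hD hk1 hk2 hk,
    card_eq_triple_sum _ _ (fun j i _ => maxDiff k j i + 1) (mem_image_cls hx₀)]
  simp [clsCount]

lemma finrank_terwilliger_half {k : ℕ} {x₀ : Finset Ω} (hx₀ : x₀.card = k)
    (hD : 2 ≤ Fintype.card Ω) (hk1 : 1 ≤ k) (hk2 : k < Fintype.card Ω)
    (hk : Fintype.card Ω = 2 * k) :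
    Module.finrank ℂ (terwilliger x₀ k) =
      ∑ j ∈ Finset.range (k + 1), ∑ i ∈ Finset.range (k + 1),
        ∑ b ∈ Finset.range (maxDiff k j i + 1), (b + 1) := by
  rw [finrank_terwilliger, finrank_terwMat_half hx₀ hD hk1 hk2 hk,
    card_eq_triple_sum _ _ (fun _ _ b => b + 1) (mem_image_symCls hx₀ hk)]

end Johnson

/-! ### Evaluation of the counts -/

lemma floor_qTerm_add_two (n : ℕ) : ⌊qTerm (n + 2)⌋ = ⌊qTerm n⌋ + (n + 1).choose 3 := by
  have h : qTerm (n + 2) = qTerm n + (((n + 1).choose 3 : ℕ) : ℤ) := by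
    have h4 : (n + 2).choose 4 = n.choose 2 + 2 * n.choose 3 + n.choose 4 := by
      simp only [Nat.choose_succ_succ' _ 2, Nat.choose_succ_succ' _ 3]
      ring
    have h3 : (n + 2).choose 3 = n + 2 * n.choose 2 + n.choose 3 := by
      simp only [Nat.choose_succ_succ' _ 1, Nat.choose_succ_succ' _ 2, Nat.choose_one_right]
      ring
    have h2 : (n + 2).choose 2 = 1 + 2 * n + n.choose 2 := by
      simp only [Nat.choose_succ_succ' _ 1, Nat.choose_one_right]
      ring
    have h3' : (n + 1).choose 3 = n.choose 2 + n.choose 3 := Nat.choose_succ_succ' _ _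
    simp only [qTerm, h4, h3, h2, h3', Nat.choose_one_right]
    push_cast
    ring
  rw [h, Int.floor_add_intCast]

lemma floor_qTerm_two : ⌊qTerm 2⌋ = 0 := by
  rw [Int.floor_eq_zero_iff]
  norm_num [qTerm, Nat.choose]

lemma floor_qTerm_three : ⌊qTerm 3⌋ = 0 := by
  rw [Int.floor_eq_zero_iff]
  norm_num [qTerm, Nat.choose]

lemma floor_qTerm_four : ⌊qTerm 4⌋ = 1 := by
  rw [floor_qTerm_add_two 2, floor_qTerm_two]
  rfl

lemma floor_qTerm_five : ⌊qTerm 5⌋ = 4 := by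
  rw [floor_qTerm_add_two 3, floor_qTerm_three]
  rfl

lemma choose_three_add_two (n : ℕ) : (n + 2).choose 3 = n.choose 3 + n ^ 2 := by
  have h : n + 2 * n.choose 2 = n ^ 2 := by
    induction n with
    | zero => rfl
    | succ n ih =>
      rw [Nat.choose_succ_succ' n 1, Nat.choose_one_right]
      linarith
  rw [← h, Nat.choose_succ_succ' (n + 1) 2, Nat.choose_succ_succ' n 1, Nat.choose_succ_succ' n 2,
    Nat.choose_one_right]
  ring

/-- If `F` agrees with `G` on the boundary of a square and exceeds it by `F'` in the interior,
then the sum of `F` exceeds the one of `G` by the one of `F'`. -/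
lemma sum_shell (k : ℕ) (F F' G : ℕ → ℕ → ℕ)
    (h : ∀ j i, j = 0 ∨ i = 0 ∨ j = k + 2 ∨ i = k + 2 → F j i = G j i)
    (h' : ∀ j i, j ≤ k → i ≤ k → F (j + 1) (i + 1) = F' j i + G (j + 1) (i + 1)) :
    ∑ j ∈ Finset.range (k + 3), ∑ i ∈ Finset.range (k + 3), F j i =
      ∑ j ∈ Finset.range (k + 1), ∑ i ∈ Finset.range (k + 1), F' j i +
        ∑ j ∈ Finset.range (k + 3), ∑ i ∈ Finset.range (k + 3), G j i := by
  have peel : ∀ f : ℕ → ℕ, ∑ j ∈ Finset.range (k + 3), f j =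
      ∑ j ∈ Finset.range (k + 1), f (j + 1) + (f 0 + f (k + 2)) := by
    intro f
    rw [Finset.sum_range_succ, Finset.sum_range_succ', add_assoc]
  have h0 : ∀ i, F 0 i = G 0 i := fun i => h _ _ (by omega)
  have h1 : ∀ i, F (k + 2) i = G (k + 2) i := fun i => h _ _ (by omega)
  have h2 : ∀ j, F j 0 = G j 0 := fun j => h _ _ (by omega)
  have h3 : ∀ j, F j (k + 2) = G j (k + 2) := fun j => h _ _ (by omega)
  have h4 : ∑ j ∈ Finset.range (k + 1), ∑ i ∈ Finset.range (k + 1), F (j + 1) (i + 1) =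
      ∑ j ∈ Finset.range (k + 1), ∑ i ∈ Finset.range (k + 1), F' j i +
        ∑ j ∈ Finset.range (k + 1), ∑ i ∈ Finset.range (k + 1), G (j + 1) (i + 1) := by
    simp only [← Finset.sum_add_distrib]
    exact Finset.sum_congr rfl fun j hj => Finset.sum_congr rfl fun i hi =>
      h' j i (Finset.mem_range_succ_iff.1 hj) (Finset.mem_range_succ_iff.1 hi)
  rw [peel, peel fun j => ∑ i ∈ Finset.range (k + 3), G j i]
  simp only [h0, h1]
  simp only [peel, h2, h3, Finset.sum_add_distrib, h4]
  ring

lemma maxDiff_succ {n j i : ℕ} (hj : j ≤ n) (hi : i ≤ n) :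
    maxDiff (n + 2) (j + 1) (i + 1) = maxDiff n j i + 1 := by
  unfold maxDiff
  omega

lemma maxDiff_boundary {n j i : ℕ} (h : j = 0 ∨ i = 0 ∨ j = n ∨ i = n) : maxDiff n j i = 0 := by
  unfold maxDiff
  omega

/-- The sum of `maxDiff n j i + 1` over a square. -/
def diffSum (n k : ℕ) : ℕ :=
  ∑ j ∈ Finset.range (k + 1), ∑ i ∈ Finset.range (k + 1), (maxDiff n j i + 1)

lemma diffSum_self (k : ℕ) : diffSum k k = (k + 3).choose 3 := by
  induction k using Nat.twoStepInduction with
  | zero => rfl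
  | one => rfl
  | more k ih _ =>
    have h := sum_shell k (fun j i => maxDiff (k + 2) j i + 1) (fun j i => maxDiff k j i + 1)
      (fun _ _ => 1) (fun j i hij => by rw [maxDiff_boundary hij])
      (fun j i hj hi => by rw [maxDiff_succ hj hi])
    rw [choose_three_add_two (k + 3), ← ih, diffSum, h]
    simp [diffSum, sq]

lemma diffSum_succ {n k : ℕ} (hkn : k ≤ n) :
    diffSum (n + 2) (k + 1) = diffSum n k + (k + 2) ^ 2 := by
  unfold diffSum
  rw [Finset.sum_range_succ']
  simp only [Finset.sum_range_succ' _ (k + 1)]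
  have h : ∑ j ∈ Finset.range (k + 1), ∑ i ∈ Finset.range (k + 1),
        maxDiff (n + 2) (j + 1) (i + 1) =
      ∑ j ∈ Finset.range (k + 1), ∑ i ∈ Finset.range (k + 1), (maxDiff n j i + 1) := by
    refine Finset.sum_congr rfl fun j hj => Finset.sum_congr rfl fun i hi => ?_
    rw [maxDiff_succ ((Finset.mem_range_succ_iff.1 hj).trans hkn)
      ((Finset.mem_range_succ_iff.1 hi).trans hkn)]
  have h0 : ∀ i, maxDiff (n + 2) 0 i = 0 := fun i => maxDiff_boundary (by omega)
  have h1 : ∀ i, maxDiff (n + 2) i 0 = 0 := fun i => maxDiff_boundary (by omega)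
  simp only [Finset.sum_add_distrib, h, h0, h1, Finset.sum_const, Finset.card_range,
    smul_eq_mul]
  ring

lemma diffSum_add (d k : ℕ) :
    diffSum (k + d) k + (k - d + 2).choose 3 = (k + 2).choose 3 + (k + 3).choose 3 := by
  induction d generalizing k with
  | zero => rw [add_zero, diffSum_self, Nat.sub_zero, add_comm]
  | succ d ih =>
    cases k with
    | zero => simp [diffSum, maxDiff]
    | succ k =>
      rw [show k + 1 + (d + 1) = k + d + 2 by ring, diffSum_succ (by omega), Nat.add_sub_add_right]
      have := ih k
      have h3 := choose_three_add_two (k + 2)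
      rw [show k + 1 + 2 = k + 3 by rfl, show k + 1 + 3 = k + 4 by rfl]
      linarith

lemma sum_half (k : ℕ) :
    ((∑ j ∈ Finset.range (k + 1), ∑ i ∈ Finset.range (k + 1),
      ∑ b ∈ Finset.range (maxDiff k j i + 1), (b + 1) : ℕ) : ℤ) = ⌊qTerm (k + 4)⌋ := by
  induction k using Nat.twoStepInduction with
  | zero => exact floor_qTerm_four.symm
  | one => exact floor_qTerm_five.symm
  | more k ih _ =>
    have h := sum_shell k (fun j i => ∑ b ∈ Finset.range (maxDiff (k + 2) j i + 1), (b + 1))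
      (fun j i => ∑ b ∈ Finset.range (maxDiff k j i + 1), (b + 1))
      (fun j i => maxDiff (k + 2) j i + 1) (fun j i hij => by rw [maxDiff_boundary hij]; rfl)
      (fun j i hj hi => by rw [maxDiff_succ hj hi, Finset.sum_range_succ])
    rw [h, Nat.cast_add, ih, floor_qTerm_add_two (k + 4)]
    exact congrArg _ (congrArg _ (diffSum_self (k + 2)))

lemma clsCount_add_two (k d : ℕ) :
    clsCount (k + 2) (k + 2 + d) =
      clsCount k (k + d) + diffSum k k + diffSum (k + 2 + d) (k + 2) := by
  have hd : k + 2 + d = k + d + 2 := by ring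
  simp only [clsCount, diffSum, Nat.min_eq_left (Nat.le_add_right _ d), ← Finset.sum_add_distrib]
  refine (sum_shell k _ (fun j i => (maxDiff (k + d) j i + 1) * (maxDiff k j i + 1) +
    (maxDiff k j i + 1)) (fun j i => maxDiff (k + 2 + d) j i + 1) (fun j i hij => ?_)
    fun j i hj hi => ?_)
  · rw [maxDiff_boundary (n := k + 2) hij, zero_add, mul_one]
  · rw [hd, maxDiff_succ (n := k + d) (by omega) (by omega), maxDiff_succ hj hi]
    ring

lemma clsCount_eq {d : ℕ} (hd : 1 ≤ d) (k : ℕ) :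
    (clsCount k (k + d) : ℤ) =
      (k + 3).choose 4 + ⌊qTerm (k + 4)⌋ - ⌊qTerm (k - d + 3)⌋ := by
  induction k using Nat.twoStepInduction with
  | zero =>
    rw [Nat.zero_sub, floor_qTerm_three, floor_qTerm_four]
    simp [clsCount, maxDiff]
  | one =>
    rw [Nat.sub_eq_zero_of_le hd, floor_qTerm_three, floor_qTerm_five]
    obtain ⟨e, rfl⟩ := Nat.exists_eq_add_of_le hd
    have : clsCount 1 (1 + (1 + e)) = 5 := by
      simp [clsCount, maxDiff, Finset.sum_range_succ]
    rw [this]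
    rfl
  | more k ih _ =>
    have h1 := diffSum_add d (k + 2)
    have h2 : ⌊qTerm (k + 2 - d + 3)⌋ = ⌊qTerm (k - d + 3)⌋ + (k + 2 - d + 2).choose 3 := by
      rcases le_or_gt d k with h | h
      · rw [show k + 2 - d = k - d + 2 by omega]
        exact floor_qTerm_add_two (k - d + 3)
      · rw [Nat.sub_eq_zero_of_le h.le, zero_add, floor_qTerm_three]
        rcases eq_or_lt_of_le (Nat.succ_le_of_lt h) with rfl | h'
        · rw [show k + 2 - (k + 1) = 1 by omega, floor_qTerm_four]
          rfl
        · rw [Nat.sub_eq_zero_of_le h', floor_qTerm_three]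
          rfl
    have h3 : (k + 5).choose 4 = (k + 3).choose 4 + (k + 3).choose 3 + (k + 4).choose 3 := by
      rw [Nat.choose_succ_succ' (k + 4) 3, Nat.choose_succ_succ' (k + 3) 3]
      ring
    rw [clsCount_add_two, diffSum_self, h2, show k + 2 + 3 = k + 5 by rfl, h3,
      floor_qTerm_add_two (k + 4)]
    push_cast
    rw [ih]
    zify at h1
    linarith

/-- Theorem 6.8: the dimension of the Terwilliger algebra `𝐓(x₀)` of the Johnson graph
`J(D,k)` (`D ≥ 2`, `1 ≤ k ≤ D-1`, `x₀` a `k`-element subset of `Ω`), in terms of binomial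
coefficients, in the five ranges `k < D/3`, `D/3 ≤ k < D/2`, `k = D/2`, `D/2 < k ≤ 2D/3`,
`2D/3 < k ≤ D-1`. -/
theorem dim_terwilliger_johnson {Ω : Type} [Fintype Ω] [DecidableEq Ω]
    (hD : 2 ≤ Fintype.card Ω) (k : ℕ) (hk1 : 1 ≤ k) (hk2 : k ≤ Fintype.card Ω - 1)
    (x₀ : Finset Ω) (hx₀ : x₀.card = k) :
    (3 * k < Fintype.card Ω →
      (Module.finrank ℂ (terwilliger x₀ k) : ℤ) =
        (k+3).choose 4 + ⌊qTerm (k+4)⌋) ∧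
    (Fintype.card Ω ≤ 3 * k → 2 * k < Fintype.card Ω →
      (Module.finrank ℂ (terwilliger x₀ k) : ℤ) =
        (k+3).choose 4 + ⌊qTerm (k+4)⌋ - ⌊qTerm (3*k - Fintype.card Ω + 3)⌋) ∧
    (Fintype.card Ω = 2 * k →
      (Module.finrank ℂ (terwilliger x₀ k) : ℤ) =
        ⌊qTerm (Fintype.card Ω / 2 + 4)⌋) ∧
    (Fintype.card Ω < 2 * k → 3 * k ≤ 2 * Fintype.card Ω →
      (Module.finrank ℂ (terwilliger x₀ k) : ℤ) =
        (Fintype.card Ω - k + 3).choose 4 + ⌊qTerm (Fintype.card Ω - k + 4)⌋ -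
          ⌊qTerm (2 * Fintype.card Ω - 3*k + 3)⌋) ∧
    (2 * Fintype.card Ω < 3 * k →
      (Module.finrank ℂ (terwilliger x₀ k) : ℤ) =
        (Fintype.card Ω - k + 3).choose 4 + ⌊qTerm (Fintype.card Ω - k + 4)⌋) := by
  have hlt : k < Fintype.card Ω := by omega
  have small : 2 * k < Fintype.card Ω → (Module.finrank ℂ (terwilliger x₀ k) : ℤ) =
      (k + 3).choose 4 + ⌊qTerm (k + 4)⌋ - ⌊qTerm (3 * k - Fintype.card Ω + 3)⌋ := by
    intro h
    rw [finrank_terwilliger_eq_clsCount hx₀ hD hk1 hlt (by omega),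
      show Fintype.card Ω - k = k + (Fintype.card Ω - 2 * k) by omega, clsCount_eq (by omega),
      show k - (Fintype.card Ω - 2 * k) = 3 * k - Fintype.card Ω by omega]
  have large : Fintype.card Ω < 2 * k → (Module.finrank ℂ (terwilliger x₀ k) : ℤ) =
      (Fintype.card Ω - k + 3).choose 4 + ⌊qTerm (Fintype.card Ω - k + 4)⌋ -
        ⌊qTerm (2 * Fintype.card Ω - 3 * k + 3)⌋ := by
    intro h
    obtain ⟨n, hn⟩ : ∃ n, n = Fintype.card Ω - k := ⟨_, rfl⟩
    obtain ⟨d, rfl⟩ : ∃ d, k = n + d := ⟨k - n, by omega⟩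
    rw [finrank_terwilliger_eq_clsCount hx₀ hD hk1 hlt (by omega), clsCount_comm, ← hn,
      clsCount_eq (by omega), show n - d = 2 * Fintype.card Ω - 3 * (n + d) by omega]
  refine ⟨fun h => ?_, fun _ h => small h, fun h => ?_, fun h _ => large h, fun h => ?_⟩
  · rw [small (by omega), Nat.sub_eq_zero_of_le h.le, floor_qTerm_three, sub_zero]
  · rw [finrank_terwilliger_half hx₀ hD hk1 hlt h, sum_half,
      show Fintype.card Ω / 2 = k by omega]
  · rw [large (by omega), Nat.sub_eq_zero_of_le h.le, floor_qTerm_three, sub_zero]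
end
end
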